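/- (Main theorem, necessity of the characterisation.) Suppose κ is a skewon-free invertible medium tensor on ℝ⁴ whose Fresnel polynomial has zero set equal to N(g₊) ∪ N(g₋) for two Lorentz metrics g₊, g₋ with N(g₊) ≠ N(g₋). Then: (a) the zero set of the Fresnel polynomial of κ contains no 2-dimensional linear subspace of ℝ⁴; and (b) there exist μ ∈ ℝ, λ > 0, ρ ∈ ℝ∖{0} and nonzero bivectors A, B such that (κ + μ·Id)∘(κ + μ·Id) = −λ·Id + ρ(Ā⊗B) + ρ(B̄⊗A). -/

import Mathlib

noncomputable section
open Matrix BigOperators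

/-- Medium tensor components `κ^{ij}_{rs}` on ℝ⁴ (upper indices first). -/
abbrev MT := Fin 4 → Fin 4 → Fin 4 → Fin 4 → ℝ

/-- Bivector (or 2-form) components on ℝ⁴. -/
abbrev BV := Fin 4 → Fin 4 → ℝ

/-- Totally antisymmetric Levi-Civita symbol on {0,1,2,3} with ε₀₁₂₃ = 1. -/
def eps (i j k l : Fin 4) : ℝ :=
  ((j.val : ℝ) - i.val) * ((k.val : ℝ) - i.val) * ((l.val : ℝ) - i.val) *
    ((k.val : ℝ) - j.val) * ((l.val : ℝ) - j.val) * ((l.val : ℝ) - k.val) / 12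

/-- Identity medium tensor `Id^{ij}_{rs} = δ^i_r δ^j_s − δ^i_s δ^j_r`. -/
def idT : MT := fun i j r s =>
  (if i = r then (1 : ℝ) else 0) * (if j = s then 1 else 0) -
    (if i = s then 1 else 0) * (if j = r then 1 else 0)

/-- Composition `(κ∘η)^{ij}_{rs} = (1/2) κ^{ab}_{rs} η^{ij}_{ab}`. -/
def compT (κ η : MT) : MT := fun i j r s => (1 / 2) * ∑ a, ∑ b, κ a b r s * η i j a b

/-- Poincaré adjoint `κ̄^{ij}_{rs} = (1/4) ε_{rsab} κ^{ab}_{cd} ε^{cdij}`. -/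
def adjT (κ : MT) : MT := fun i j r s =>
  (1 / 4) * ∑ a, ∑ b, ∑ c, ∑ d, eps r s a b * κ a b c d * eps c d i j

/-- Trace `tr κ = (1/2) κ^{ij}_{ij}`. -/
def traceT (κ : MT) : ℝ := (1 / 2) * ∑ i, ∑ j, κ i j i j

def antisymBV (A : BV) : Prop := ∀ i j, A i j = - A j i

def antisymMT (κ : MT) : Prop :=
  (∀ i j r s, κ i j r s = - κ j i r s) ∧ (∀ i j r s, κ i j r s = - κ i j s r)

/-- The medium tensor `(ρ Ā⊗B)^{ij}_{rs} = ρ ε_{rsab} A^{ab} B^{ij}`. -/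
def tensAB (ρ : ℝ) (A B : BV) : MT := fun i j r s =>
  ρ * (∑ a, ∑ b, eps r s a b * A a b) * B i j

/-- Hodge star `(∗_g)^{ij}_{rs} = √|det g| g^{ia} g^{jb} ε_{abrs}`. -/
def hodge (g : Matrix (Fin 4) (Fin 4) ℝ) : MT := fun i j r s =>
  Real.sqrt |g.det| * ∑ a, ∑ b, g⁻¹ i a * g⁻¹ j b * eps a b r s

/-- The (non-symmetrised) Fresnel tensor density `𝒢₀^{ijkl}`. -/
def G0 (κ : MT) (i j k l : Fin 4) : ℝ :=
  (1 / 48) * ∑ a₁, ∑ a₂, ∑ a₃, ∑ a₄, ∑ b₁, ∑ b₂, ∑ b₃, ∑ b₄, ∑ b₅, ∑ b₆,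
    κ a₁ a₂ b₁ b₂ * κ a₃ i b₃ b₄ * κ a₄ j b₅ b₆ *
      eps b₁ b₂ b₅ k * eps b₃ b₄ b₆ l * eps a₁ a₂ a₃ a₄

/-- Fresnel polynomial `G(ξ) = 𝒢₀^{ijkl} ξ_i ξ_j ξ_k ξ_l`. -/
def fresnel (κ : MT) (ξ : Fin 4 → ℝ) : ℝ :=
  ∑ i, ∑ j, ∑ k, ∑ l, G0 κ i j k l * ξ i * ξ j * ξ k * ξ l

/-- A Lorentz metric: real symmetric invertible 4×4 matrix of signature
(−+++) or (+−−−), equivalently symmetric with negative determinant. -/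
def IsLorentz (g : Matrix (Fin 4) (Fin 4) ℝ) : Prop := g.IsSymm ∧ g.det < 0

/-- Null cone `N(g) = {ξ : g^{ij} ξ_i ξ_j = 0}` (on covectors, via the inverse metric). -/
def nullCone (g : Matrix (Fin 4) (Fin 4) ℝ) : Set (Fin 4 → ℝ) :=
  {ξ | ∑ i, ∑ j, g⁻¹ i j * ξ i * ξ j = 0}

/-- The ordering O = (01, 02, 03, 23, 31, 12) of index pairs. -/
def pairs : Fin 6 → Fin 4 × Fin 4 := ![(0, 1), (0, 2), (0, 3), (2, 3), (3, 1), (1, 2)]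

/-- The 6×6 matrix representing a medium tensor: `M_{IJ} = κ^{J₁J₂}_{I₁I₂}`. -/
def mat6 (κ : MT) : Matrix (Fin 6) (Fin 6) ℝ := fun I J =>
  κ (pairs J).1 (pairs J).2 (pairs I).1 (pairs I).2

/-- The Fresnel surface decomposes into a double light cone. -/
def DoubleCone (κ : MT) : Prop :=
  ∃ gp gm, IsLorentz gp ∧ IsLorentz gm ∧ nullCone gp ≠ nullCone gm ∧
    {ξ | fresnel κ ξ = 0} = nullCone gp ∪ nullCone gm

/-- The matrix of the wedge pairing on two-forms in the ordering `O`. -/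
def wedgeMat : Matrix (Fin 6) (Fin 6) ℝ := fun i j => if j = i + 3 then 1 else 0

/-- The components of `a ∧ b` in the ordering `O`. -/
def wedge (a b : Fin 4 → ℝ) : Fin 6 → ℝ := fun I =>
  a (pairs I).1 * b (pairs I).2 - a (pairs I).2 * b (pairs I).1

/-- The Gram determinant of `ξ ∧ a`, `ξ ∧ b`, `ξ ∧ c` for the bilinear form with matrix `X`. -/
def gram3 (X : Matrix (Fin 6) (Fin 6) ℝ) (ξ a b c : Fin 4 → ℝ) : ℝ :=
  det !![wedge ξ a ⬝ᵥ X *ᵥ wedge ξ a, wedge ξ a ⬝ᵥ X *ᵥ wedge ξ b, wedge ξ a ⬝ᵥ X *ᵥ wedge ξ c;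
    wedge ξ b ⬝ᵥ X *ᵥ wedge ξ a, wedge ξ b ⬝ᵥ X *ᵥ wedge ξ b, wedge ξ b ⬝ᵥ X *ᵥ wedge ξ c;
    wedge ξ c ⬝ᵥ X *ᵥ wedge ξ a, wedge ξ c ⬝ᵥ X *ᵥ wedge ξ b, wedge ξ c ⬝ᵥ X *ᵥ wedge ξ c]

lemma sum_eps (F : Fin 4 → Fin 4 → Fin 4 → Fin 4 → ℝ) :
    ∑ a, ∑ b, ∑ c, ∑ d, F a b c d * eps a b c d =
      F 0 1 2 3 - F 0 1 3 2 - F 0 2 1 3 + F 0 2 3 1 + F 0 3 1 2 - F 0 3 2 1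
      - F 1 0 2 3 + F 1 0 3 2 + F 1 2 0 3 - F 1 2 3 0 - F 1 3 0 2 + F 1 3 2 0
      + F 2 0 1 3 - F 2 0 3 1 - F 2 1 0 3 + F 2 1 3 0 + F 2 3 0 1 - F 2 3 1 0
      - F 3 0 1 2 + F 3 0 2 1 + F 3 1 0 2 - F 3 1 2 0 - F 3 2 0 1 + F 3 2 1 0 := by
  simp only [Fin.sum_univ_four, eps, Fin.isValue, Fin.val_zero, Fin.val_one, Fin.val_two,
    show ((3 : Fin 4) : ℕ) = 3 from rfl]
  norm_num
  ring

lemma sum_comm_ten (F : Fin 4 → Fin 4 → Fin 4 → Fin 4 → Fin 4 → Fin 4 → Fin 4 → Fin 4 → Fin 4 →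
    Fin 4 → Fin 4 → ℝ) :
    ∑ i, ∑ a₁, ∑ a₂, ∑ a₃, ∑ a₄, ∑ b₁, ∑ b₂, ∑ b₃, ∑ b₄, ∑ b₅, ∑ b₆,
      F i a₁ a₂ a₃ a₄ b₁ b₂ b₃ b₄ b₅ b₆ =
    ∑ a₁, ∑ a₂, ∑ a₃, ∑ a₄, ∑ b₁, ∑ b₂, ∑ b₃, ∑ b₄, ∑ b₅, ∑ b₆, ∑ i,
      F i a₁ a₂ a₃ a₄ b₁ b₂ b₃ b₄ b₅ b₆ := by
  iterate 9
    rw [Finset.sum_comm]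
    refine Finset.sum_congr rfl fun _ _ => ?_
  exact Finset.sum_comm

lemma sum_comm_four_ten (F : Fin 4 → Fin 4 → Fin 4 → Fin 4 → Fin 4 → Fin 4 → Fin 4 → Fin 4 →
    Fin 4 → Fin 4 → Fin 4 → Fin 4 → Fin 4 → Fin 4 → ℝ) :
    ∑ i, ∑ j, ∑ k, ∑ l, ∑ a₁, ∑ a₂, ∑ a₃, ∑ a₄, ∑ b₁, ∑ b₂, ∑ b₃, ∑ b₄, ∑ b₅, ∑ b₆,
      F i j k l a₁ a₂ a₃ a₄ b₁ b₂ b₃ b₄ b₅ b₆ =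
    ∑ a₁, ∑ a₂, ∑ a₃, ∑ a₄, ∑ b₁, ∑ b₂, ∑ b₃, ∑ b₄, ∑ b₅, ∑ b₆, ∑ i, ∑ j, ∑ k, ∑ l,
      F i j k l a₁ a₂ a₃ a₄ b₁ b₂ b₃ b₄ b₅ b₆ := by
  calc
    _ = ∑ i, ∑ j, ∑ k, ∑ a₁, ∑ a₂, ∑ a₃, ∑ a₄, ∑ b₁, ∑ b₂, ∑ b₃, ∑ b₄, ∑ b₅, ∑ b₆, ∑ l,
          F i j k l a₁ a₂ a₃ a₄ b₁ b₂ b₃ b₄ b₅ b₆ :=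
      Finset.sum_congr rfl fun i _ => Finset.sum_congr rfl fun j _ => Finset.sum_congr rfl
        fun k _ => sum_comm_ten fun l => F i j k l
    _ = ∑ i, ∑ j, ∑ a₁, ∑ a₂, ∑ a₃, ∑ a₄, ∑ b₁, ∑ b₂, ∑ b₃, ∑ b₄, ∑ b₅, ∑ b₆, ∑ k, ∑ l,
          F i j k l a₁ a₂ a₃ a₄ b₁ b₂ b₃ b₄ b₅ b₆ :=
      Finset.sum_congr rfl fun i _ => Finset.sum_congr rfl fun j _ =>
        sum_comm_ten fun k a₁ a₂ a₃ a₄ b₁ b₂ b₃ b₄ b₅ b₆ =>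
          ∑ l, F i j k l a₁ a₂ a₃ a₄ b₁ b₂ b₃ b₄ b₅ b₆
    _ = ∑ i, ∑ a₁, ∑ a₂, ∑ a₃, ∑ a₄, ∑ b₁, ∑ b₂, ∑ b₃, ∑ b₄, ∑ b₅, ∑ b₆, ∑ j, ∑ k, ∑ l,
          F i j k l a₁ a₂ a₃ a₄ b₁ b₂ b₃ b₄ b₅ b₆ :=
      Finset.sum_congr rfl fun i _ => sum_comm_ten fun j a₁ a₂ a₃ a₄ b₁ b₂ b₃ b₄ b₅ b₆ =>
        ∑ k, ∑ l, F i j k l a₁ a₂ a₃ a₄ b₁ b₂ b₃ b₄ b₅ b₆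
    _ = _ := sum_comm_ten fun i a₁ a₂ a₃ a₄ b₁ b₂ b₃ b₄ b₅ b₆ =>
        ∑ j, ∑ k, ∑ l, F i j k l a₁ a₂ a₃ a₄ b₁ b₂ b₃ b₄ b₅ b₆

lemma fresnel_eq_sum (κ : MT) (ξ : Fin 4 → ℝ) :
    fresnel κ ξ = (1 / 48) * ∑ a₁, ∑ a₂, ∑ a₃, ∑ a₄,
      (∑ b₅, ∑ b₆, (∑ b₁, ∑ b₂, ∑ k, κ a₁ a₂ b₁ b₂ * ξ k * eps b₁ b₂ b₅ k) *
        (∑ b₃, ∑ b₄, ∑ i, ∑ l, κ a₃ i b₃ b₄ * ξ i * ξ l * eps b₃ b₄ b₆ l) *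
        (∑ j, κ a₄ j b₅ b₆ * ξ j)) * eps a₁ a₂ a₃ a₄ := by
  have key : fresnel κ ξ = (1 / 48) * ∑ a₁, ∑ a₂, ∑ a₃, ∑ a₄, ∑ b₁, ∑ b₂, ∑ b₃, ∑ b₄, ∑ b₅, ∑ b₆,
      ∑ i, ∑ j, ∑ k, ∑ l, (κ a₁ a₂ b₁ b₂ * ξ k * eps b₁ b₂ b₅ k) *
        (κ a₃ i b₃ b₄ * ξ i * ξ l * eps b₃ b₄ b₆ l) *
        (κ a₄ j b₅ b₆ * ξ j) * eps a₁ a₂ a₃ a₄ := by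
    rw [← sum_comm_four_ten]
    unfold fresnel G0
    iterate 4
      rw [Finset.mul_sum]
      refine Finset.sum_congr rfl fun _ _ => ?_
    rw [mul_assoc, mul_assoc, mul_assoc, mul_assoc]
    congr 1
    iterate 10
      rw [Finset.sum_mul]
      refine Finset.sum_congr rfl fun _ _ => ?_
    ring
  rw [key]
  congr 1
  refine Finset.sum_congr rfl fun a₁ _ => Finset.sum_congr rfl fun a₂ _ =>
    Finset.sum_congr rfl fun a₃ _ => Finset.sum_congr rfl fun a₄ _ => ?_
  have comm₁ (F : Fin 4 → Fin 4 → Fin 4 → Fin 4 → Fin 4 → ℝ) :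
      ∑ i, ∑ b₁, ∑ b₂, ∑ b₃, ∑ b₄, F i b₁ b₂ b₃ b₄ =
        ∑ b₁, ∑ b₂, ∑ b₃, ∑ b₄, ∑ i, F i b₁ b₂ b₃ b₄ := by
    iterate 3
      rw [Finset.sum_comm]
      refine Finset.sum_congr rfl fun _ _ => ?_
    exact Finset.sum_comm
  have comm₂ (F : Fin 4 → Fin 4 → Fin 4 → Fin 4 → Fin 4 → Fin 4 → ℝ) :
      ∑ b₁, ∑ b₂, ∑ b₃, ∑ b₄, ∑ b₅, ∑ b₆, F b₁ b₂ b₃ b₄ b₅ b₆ =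
        ∑ b₅, ∑ b₆, ∑ b₁, ∑ b₂, ∑ b₃, ∑ b₄, F b₁ b₂ b₃ b₄ b₅ b₆ := by
    rw [← comm₁ fun b₅ b₁ b₂ b₃ b₄ => ∑ b₆, F b₁ b₂ b₃ b₄ b₅ b₆]
    exact Finset.sum_congr rfl fun b₅ _ => (comm₁ fun b₆ b₁ b₂ b₃ b₄ => F b₁ b₂ b₃ b₄ b₅ b₆).symm
  rw [comm₂]
  simp only [← Finset.mul_sum, ← Finset.sum_mul]

/-- Half the contraction of an antisymmetric array and a covector with the Levi-Civita symbol. -/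
def dualContr (m : Fin 4 → Fin 4 → ℝ) (ξ : Fin 4 → ℝ) : Fin 4 → ℝ :=
  ![m 2 3 * ξ 1 + m 3 1 * ξ 2 + m 1 2 * ξ 3, m 0 3 * ξ 2 - m 0 2 * ξ 3 - m 2 3 * ξ 0,
    m 0 1 * ξ 3 - m 0 3 * ξ 1 - m 3 1 * ξ 0, m 0 2 * ξ 1 - m 0 1 * ξ 2 - m 1 2 * ξ 0]

lemma sum_eps_contr (m : Fin 4 → Fin 4 → ℝ) (hm : ∀ i j, m i j = -m j i) (ξ : Fin 4 → ℝ)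
    (b : Fin 4) :
    ∑ b₁, ∑ b₂, ∑ k, m b₁ b₂ * ξ k * eps b₁ b₂ b k = 2 * dualContr m ξ b := by
  have h10 := hm 1 0
  have h20 := hm 2 0
  have h30 := hm 3 0
  have h21 := hm 2 1
  have h13 := hm 1 3
  have h32 := hm 3 2
  fin_cases b <;>
  · simp only [Fin.sum_univ_four, eps, dualContr, Fin.isValue, Fin.val_zero, Fin.val_one,
      Fin.val_two, show ((3 : Fin 4) : ℕ) = 3 from rfl, h10, h20, h30, h21, h13, h32,
      Fin.zero_eta, Fin.mk_one, Fin.reduceFinMk, cons_val]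
    norm_num
    ring

lemma fresnel_eq_sum_dualContr (κ : MT) (hκ : antisymMT κ) (ξ : Fin 4 → ℝ) :
    fresnel κ ξ = (1 / 12) * ∑ a₁, ∑ a₂, ∑ a₃, ∑ a₄,
      (∑ b₅, ∑ b₆, dualContr (κ a₁ a₂) ξ b₅ *
        dualContr (fun r s => ∑ i, κ a₃ i r s * ξ i) ξ b₆ *
        (∑ j, κ a₄ j b₅ b₆ * ξ j)) * eps a₁ a₂ a₃ a₄ := by
  have h₁ (a₁ a₂ b) := sum_eps_contr (κ a₁ a₂) (hκ.2 a₁ a₂) ξ b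
  have h₂ (a b) : ∑ b₃, ∑ b₄, ∑ i, ∑ l, κ a i b₃ b₄ * ξ i * ξ l * eps b₃ b₄ b l =
      2 * dualContr (fun r s => ∑ i, κ a i r s * ξ i) ξ b := by
    rw [← sum_eps_contr]
    · refine Finset.sum_congr rfl fun _ _ => Finset.sum_congr rfl fun _ _ => ?_
      simp only [Finset.sum_mul]
      exact Finset.sum_comm
    · intro r s
      rw [← Finset.sum_neg_distrib]
      exact Finset.sum_congr rfl fun i _ => by rw [hκ.2 a i r s]; ring
  rw [fresnel_eq_sum]
  simp only [h₁, h₂, Finset.mul_sum, Finset.sum_mul]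
  refine Finset.sum_congr rfl fun _ _ => Finset.sum_congr rfl fun _ _ => Finset.sum_congr rfl
    fun _ _ => Finset.sum_congr rfl fun _ _ => Finset.sum_congr rfl fun _ _ =>
    Finset.sum_congr rfl fun _ _ => Finset.sum_congr rfl fun _ _ => ?_
  ring

lemma gram3_eq_fresnel_of_eq_one (κ : MT) (hκ : antisymMT κ)
    (hX : (wedgeMat * mat6 κ).IsSymm) (ξ : Fin 4 → ℝ) (hξ : ξ 0 = 1) :
    gram3 (wedgeMat * mat6 κ) ξ ![0, 1, 0, 0] ![0, 0, 1, 0] ![0, 0, 0, 1] = fresnel κ ξ := by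
  obtain ⟨X, hXdef⟩ : ∃ X, X = wedgeMat * mat6 κ := ⟨_, rfl⟩
  have hK (I J : Fin 6) : κ (pairs J).1 (pairs J).2 (pairs I).1 (pairs I).2 = X (I + 3) J := by
    rw [hXdef]
    fin_cases I <;> simp [Matrix.mul_apply, wedgeMat, mat6]
  rw [← hXdef] at hX ⊢
  have e (i j : Fin 6) : X j i = X i j := hX.apply i j
  have hd (i r s) : κ i i r s = 0 := by have := hκ.1 i i r s; linarith
  have hd' (i j r) : κ i j r r = 0 := by have := hκ.2 i j r r; linarith
  have u := hκ.1
  have l := hκ.2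
  simp only [Fin.forall_fin_succ, pairs, Fin.isValue] at hK
  simp at hK
  obtain ⟨⟨k1, k2, k3, k4, k5, k6⟩, ⟨k7, k8, k9, k10, k11, k12⟩, ⟨k13, k14, k15, k16, k17, k18⟩,
    ⟨k19, k20, k21, k22, k23, k24⟩, ⟨k25, k26, k27, k28, k29, k30⟩, k31, k32, k33, k34, k35,
    k36⟩ := hK
  obtain ⟨Q, hQ⟩ : ∃ Q : Fin 6 → Fin 4 → ℝ, ∀ I b, Q I b = (X *ᵥ wedge ξ (Pi.single b 1)) I :=
    ⟨_, fun _ _ => rfl⟩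
  simp only [mulVec, dotProduct, Fin.sum_univ_six, wedge, pairs] at hQ
  have hR (I : Fin 6) (b : Fin 4) : dualContr (κ (pairs I).1 (pairs I).2) ξ b = -Q I b := by
    rw [hQ]
    fin_cases I <;> fin_cases b <;>
      simp [dualContr, pairs, k1, k2, k3, k4, k5, k6, k7, k8, k9, k10, k11, k12, k13, k14, k15, k16,
        k17, k18, k19, k20, k21, k22, k23, k24, k25, k26, k27, k28, k29, k30, k31, k32, k33, k34,
        k35, k36, e 0 1, e 0 2, e 0 3, e 0 4, e 0 5, e 1 2, e 1 3, e 1 4, e 1 5, e 2 3, e 2 4,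
        e 2 5, e 3 4, e 3 5, e 4 5] <;> ring
  have hS (I : Fin 6) (a : Fin 4) :
      ∑ i, κ a i (pairs I).1 (pairs I).2 * ξ i = -Q (I + 3) a := by
    rw [hQ]
    fin_cases I <;> fin_cases a <;>
      simp [Fin.sum_univ_four, pairs, hd, u 1 0, u 2 0, u 3 0, u 2 1, u 1 3, u 3 2, k1, k2, k3, k4,
        k5, k6, k7, k8, k9, k10, k11, k12, k13, k14, k15, k16,
        k17, k18, k19, k20, k21, k22, k23, k24, k25, k26, k27, k28, k29, k30, k31, k32, k33, k34,
        k35, k36, e 0 1, e 0 2, e 0 3, e 0 4, e 0 5, e 1 2, e 1 3, e 1 4, e 1 5, e 2 3, e 2 4,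
        e 2 5, e 3 4, e 3 5, e 4 5] <;> ring
  have hS0 (a r) : ∑ i, κ a i r r * ξ i = 0 := by simp [hd']
  have hSl (a r s) : ∑ i, κ a i r s * ξ i = -∑ i, κ a i s r * ξ i := by
    rw [← Finset.sum_neg_distrib]
    exact Finset.sum_congr rfl fun i _ => by rw [l a i r s]; ring
  obtain ⟨p, hp⟩ : ∃ p : Fin 4 → Fin 4 → ℝ, ∀ a b, p a b =
      wedge ξ (Pi.single a 1) ⬝ᵥ X *ᵥ wedge ξ (Pi.single b 1) := ⟨_, fun _ _ => rfl⟩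
  have hp_symm (a b) : p a b = p b a := by
    rw [hp, hp, dotProduct_mulVec, ← mulVec_transpose, hX, dotProduct_comm]
  have hgram : gram3 X ξ ![0, 1, 0, 0] ![0, 0, 1, 0] ![0, 0, 0, 1] =
      det !![p 1 1, p 1 2, p 1 3; p 2 1, p 2 2, p 2 3; p 3 1, p 3 2, p 3 3] := by
    have s1 : (![0, 1, 0, 0] : Fin 4 → ℝ) = Pi.single 1 1 := by ext i; fin_cases i <;> simp
    have s2 : (![0, 0, 1, 0] : Fin 4 → ℝ) = Pi.single 2 1 := by ext i; fin_cases i <;> simp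
    have s3 : (![0, 0, 0, 1] : Fin 4 → ℝ) = Pi.single 3 1 := by ext i; fin_cases i <;> simp
    simp only [gram3, s1, s2, s3, hp]
  have hpQ (a b) : p a b = ∑ I, wedge ξ (Pi.single a 1) I * Q I b := by
    simp only [hp, hQ, dotProduct, mulVec, Fin.sum_univ_six, wedge, pairs]
  have hQ0 (I) : Q I 0 = -(ξ 1 * Q I 1 + ξ 2 * Q I 2 + ξ 3 * Q I 3) := by
    simp only [hQ]
    simp [hξ]
    ring
  have hQ1 (j) : Q 0 j = p 1 j - ξ 3 * Q 4 j + ξ 2 * Q 5 j := by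
    rw [hpQ]; simp [Fin.sum_univ_six, wedge, pairs, hξ]; ring
  have hQ2 (j) : Q 1 j = p 2 j + ξ 3 * Q 3 j - ξ 1 * Q 5 j := by
    rw [hpQ]; simp [Fin.sum_univ_six, wedge, pairs, hξ]; ring
  have hQ3 (j) : Q 2 j = p 3 j - ξ 2 * Q 3 j + ξ 1 * Q 4 j := by
    rw [hpQ]; simp [Fin.sum_univ_six, wedge, pairs, hξ]; ring
  simp only [Fin.forall_fin_succ, pairs] at hR hS
  simp at hR hS
  obtain ⟨⟨R1, R2, R3, R4⟩, ⟨R5, R6, R7, R8⟩, ⟨R9, R10, R11, R12⟩, ⟨R13, R14, R15, R16⟩,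
    ⟨R17, R18, R19, R20⟩, R21, R22, R23, R24⟩ := hR
  obtain ⟨⟨S1, S2, S3, S4⟩, ⟨S5, S6, S7, S8⟩, ⟨S9, S10, S11, S12⟩, ⟨S13, S14, S15, S16⟩,
    ⟨S17, S18, S19, S20⟩, S21, S22, S23, S24⟩ := hS
  have hP (a b : Fin 4) : dualContr (fun r s => ∑ i, κ a i r s * ξ i) ξ b = p b a := by
    rw [hpQ]
    fin_cases a <;> fin_cases b <;>
      simp [dualContr, S1, S2, S3, S4, S5, S6, S7, S8, S9, S10, S11, S12, S13, S14, S15, S16, S17,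
        S18, S19, S20, S21, S22, S23, S24, Fin.sum_univ_six, wedge, pairs] <;> ring
  have hRl (i j b) : dualContr (κ i j) ξ b = -dualContr (κ j i) ξ b := by
    have : κ i j = fun r s => -κ j i r s := by ext r s; exact u i j r s
    rw [this]
    fin_cases b <;> simp [dualContr] <;> ring
  have hp0 (j) : p 0 j = -(ξ 1 * p 1 j + ξ 2 * p 2 j + ξ 3 * p 3 j) := by
    simp only [hpQ]; simp [Fin.sum_univ_six, wedge, pairs, hξ]; ring
  rw [hgram, fresnel_eq_sum_dualContr κ hκ, sum_eps]
  clear hX hXdef hQ hpQ hgram hp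
  simp only [hP, hRl 1 0, hRl 2 0, hRl 3 0, hRl 2 1, hRl 1 3, hRl 3 2]
  obtain ⟨s, hs⟩ : ∃ s : Fin 4 → Fin 4 → Fin 4 → ℝ, ∀ a r c, ∑ j, κ a j r c * ξ j = s a r c :=
    ⟨_, fun _ _ _ => rfl⟩
  simp only [hs] at S1 S2 S3 S4 S5 S6 S7 S8 S9 S10 S11 S12 S13 S14 S15 S16
  simp only [hs] at S17 S18 S19 S20 S21 S22 S23 S24 hS0 hSl ⊢
  clear hs hP hRl
  simp only [Fin.sum_univ_four, hS0, hSl _ 1 0, hSl _ 2 0, hSl _ 3 0, hSl _ 2 1, hSl _ 1 3,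
    hSl _ 3 2, R1, R2, R3, R4, R5, R6, R7, R8, R9, R10, R11, R12, R13, R14, R15, R16, R17, R18,
    R19, R20, R21, R22, R23, R24, S1, S2, S3, S4, S5, S6, S7, S8, S9, S10, S11, S12, S13, S14, S15,
    S16, S17, S18, S19, S20, S21, S22, S23, S24]
  simp only [hQ0, hQ1, hQ2, hQ3, hp_symm _ 0, hp0, hp_symm 2 1, hp_symm 3 1, hp_symm 3 2,
    det_fin_three, of_apply, cons_val]
  ring

lemma det_fin_four {R : Type*} [CommRing R] (M : Matrix (Fin 4) (Fin 4) R) :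
    M.det = M 0 0 * (M 1 1 * (M 2 2 * M 3 3 - M 2 3 * M 3 2) -
        M 1 2 * (M 2 1 * M 3 3 - M 2 3 * M 3 1) + M 1 3 * (M 2 1 * M 3 2 - M 2 2 * M 3 1)) -
      M 0 1 * (M 1 0 * (M 2 2 * M 3 3 - M 2 3 * M 3 2) -
        M 1 2 * (M 2 0 * M 3 3 - M 2 3 * M 3 0) + M 1 3 * (M 2 0 * M 3 2 - M 2 2 * M 3 0)) +
      M 0 2 * (M 1 0 * (M 2 1 * M 3 3 - M 2 3 * M 3 1) -
        M 1 1 * (M 2 0 * M 3 3 - M 2 3 * M 3 0) + M 1 3 * (M 2 0 * M 3 1 - M 2 1 * M 3 0)) -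
      M 0 3 * (M 1 0 * (M 2 1 * M 3 2 - M 2 2 * M 3 1) -
        M 1 1 * (M 2 0 * M 3 2 - M 2 2 * M 3 0) + M 1 2 * (M 2 0 * M 3 1 - M 2 1 * M 3 0)) := by
  rw [det_succ_row_zero]
  simp only [Fin.sum_univ_four, det_fin_three, submatrix_apply, show ((3 : Fin 4) : ℕ) = 3 from rfl,
    Fin.val_zero, Fin.val_one, Fin.val_two, Fin.isValue]
  simp only [show (0 : Fin 4).succAbove 0 = 1 from rfl, show (0 : Fin 4).succAbove 1 = 2 from rfl,
    show (0 : Fin 4).succAbove 2 = 3 from rfl, show (1 : Fin 4).succAbove 0 = 0 from rfl,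
    show (1 : Fin 4).succAbove 1 = 2 from rfl, show (1 : Fin 4).succAbove 2 = 3 from rfl,
    show (2 : Fin 4).succAbove 0 = 0 from rfl, show (2 : Fin 4).succAbove 1 = 1 from rfl,
    show (2 : Fin 4).succAbove 2 = 3 from rfl, show (3 : Fin 4).succAbove 0 = 0 from rfl,
    show (3 : Fin 4).succAbove 1 = 1 from rfl, show (3 : Fin 4).succAbove 2 = 2 from rfl,
    show Fin.succ (0 : Fin 3) = 1 from rfl, show Fin.succ (1 : Fin 3) = 2 from rfl,
    show Fin.succ (2 : Fin 3) = 3 from rfl]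
  ring

lemma wedge_smul_left (c : ℝ) (ξ a : Fin 4 → ℝ) : wedge (c • ξ) a = c • wedge ξ a := by
  ext I
  simp [wedge]
  ring

lemma wedge_add_right (ξ a b : Fin 4 → ℝ) : wedge ξ (a + b) = wedge ξ a + wedge ξ b := by
  ext I
  simp [wedge]
  ring

lemma wedge_smul_right (c : ℝ) (ξ a : Fin 4 → ℝ) : wedge ξ (c • a) = c • wedge ξ a := by
  ext I
  simp [wedge]
  ring

lemma wedge_self (ξ : Fin 4 → ℝ) : wedge ξ ξ = 0 := by
  ext I
  simp [wedge]
  ring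

lemma gram3_eq_det (X : Matrix (Fin 6) (Fin 6) ℝ) (ξ a b c : Fin 4 → ℝ) :
    gram3 X ξ a b c = (of ![wedge ξ a, wedge ξ b, wedge ξ c] * X *
      (of ![wedge ξ a, wedge ξ b, wedge ξ c])ᵀ).det := by
  unfold gram3
  congr 1
  simp only [dotProduct_mulVec]
  ext i j
  fin_cases i <;> fin_cases j <;> simp [Matrix.mul_apply, dotProduct, vecMul]

lemma gram3_of_eq_add (X : Matrix (Fin 6) (Fin 6) ℝ) (ξ : Fin 4 → ℝ) (c : Fin 3 → ℝ)
    (P : Matrix (Fin 3) (Fin 3) ℝ) (e : Fin 3 → Fin 4 → ℝ) :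
    gram3 X ξ (c 0 • ξ + ∑ j, P 0 j • e j) (c 1 • ξ + ∑ j, P 1 j • e j)
      (c 2 • ξ + ∑ j, P 2 j • e j) = gram3 X ξ (e 0) (e 1) (e 2) * P.det ^ 2 := by
  have h : of ![wedge ξ (c 0 • ξ + ∑ j, P 0 j • e j), wedge ξ (c 1 • ξ + ∑ j, P 1 j • e j),
      wedge ξ (c 2 • ξ + ∑ j, P 2 j • e j)] = P * of ![wedge ξ (e 0), wedge ξ (e 1),
      wedge ξ (e 2)] := by
    simp only [Fin.sum_univ_three, wedge_add_right, wedge_smul_right, wedge_self]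
    ext i j
    fin_cases i <;> simp [Matrix.mul_apply, Fin.sum_univ_three]
  rw [gram3_eq_det, gram3_eq_det, h, transpose_mul, show ∀ A B C : Matrix (Fin 3) (Fin 3) ℝ,
    ∀ U : Matrix (Fin 3) (Fin 6) ℝ, A * U * X * (Uᵀ * C) = A * (U * X * Uᵀ) * C from
      fun A B C U => by simp only [Matrix.mul_assoc], det_mul, det_mul, det_transpose]
  · ring
  · exact P

lemma gram3_smul (X : Matrix (Fin 6) (Fin 6) ℝ) (t : ℝ) (ξ a b c : Fin 4 → ℝ) :
    gram3 X (t • ξ) a b c = t ^ 6 * gram3 X ξ a b c := by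
  simp only [gram3, wedge_smul_left, mulVec_smul, dotProduct_smul, smul_dotProduct, smul_eq_mul,
    det_fin_three, of_apply, cons_val]
  ring

lemma fresnel_smul (κ : MT) (t : ℝ) (ξ : Fin 4 → ℝ) :
    fresnel κ (t • ξ) = t ^ 4 * fresnel κ ξ := by
  simp only [fresnel, Finset.mul_sum, Pi.smul_apply, smul_eq_mul]
  refine Finset.sum_congr rfl fun _ _ => Finset.sum_congr rfl fun _ _ =>
    Finset.sum_congr rfl fun _ _ => Finset.sum_congr rfl fun _ _ => ?_
  ring

lemma continuous_fresnel (κ : MT) : Continuous (fresnel κ) := by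
  unfold fresnel
  fun_prop

lemma continuous_wedge (a : Fin 4 → ℝ) : Continuous fun ξ => wedge ξ a := by
  unfold wedge
  fun_prop

lemma continuous_gram3 (X : Matrix (Fin 6) (Fin 6) ℝ) (a b c : Fin 4 → ℝ) :
    Continuous fun ξ => gram3 X ξ a b c := by
  have ha := continuous_wedge a
  have hb := continuous_wedge b
  have hc := continuous_wedge c
  have h (u v : (Fin 4 → ℝ) → Fin 6 → ℝ) (hu : Continuous u) (hv : Continuous v) :
      Continuous fun ξ => u ξ ⬝ᵥ X *ᵥ v ξ := by
    simp only [dotProduct, mulVec]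
    fun_prop
  simp only [gram3, det_fin_three, of_apply, cons_val]
  have := h _ _ ha ha
  have := h _ _ ha hb
  have := h _ _ ha hc
  have := h _ _ hb ha
  have := h _ _ hb hb
  have := h _ _ hb hc
  have := h _ _ hc ha
  have := h _ _ hc hb
  have := h _ _ hc hc
  fun_prop

theorem gram3_eq_fresnel (κ : MT) (hκ : antisymMT κ) (hX : (wedgeMat * mat6 κ).IsSymm)
    (ξ a b c : Fin 4 → ℝ) :
    gram3 (wedgeMat * mat6 κ) ξ a b c = fresnel κ ξ * (of ![ξ, a, b, c]).det ^ 2 := by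
  have hone (ξ : Fin 4 → ℝ) (hξ : ξ 0 = 1) :
      gram3 (wedgeMat * mat6 κ) ξ a b c = fresnel κ ξ * (of ![ξ, a, b, c]).det ^ 2 := by
    have hdec (v : Fin 4 → ℝ) : v 0 • ξ + ((v 1 - v 0 * ξ 1) • ![0, 1, 0, 0] +
        (v 2 - v 0 * ξ 2) • ![0, 0, 1, 0] + (v 3 - v 0 * ξ 3) • ![0, 0, 0, 1]) = v := by
      ext i
      fin_cases i <;> simp [hξ]
    have key := gram3_of_eq_add (wedgeMat * mat6 κ) ξ ![a 0, b 0, c 0]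
      !![a 1 - a 0 * ξ 1, a 2 - a 0 * ξ 2, a 3 - a 0 * ξ 3;
        b 1 - b 0 * ξ 1, b 2 - b 0 * ξ 2, b 3 - b 0 * ξ 3;
        c 1 - c 0 * ξ 1, c 2 - c 0 * ξ 2, c 3 - c 0 * ξ 3]
      ![![0, 1, 0, 0], ![0, 0, 1, 0], ![0, 0, 0, 1]]
    simp only [Fin.sum_univ_three, of_apply, cons_val, hdec] at key
    rw [key, gram3_eq_fresnel_of_eq_one κ hκ hX ξ hξ]
    congr 2
    simp only [det_fin_four, det_fin_three, of_apply, cons_val, hξ]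
    ring
  have hne (ξ : Fin 4 → ℝ) (hξ : ξ 0 ≠ 0) :
      gram3 (wedgeMat * mat6 κ) ξ a b c = fresnel κ ξ * (of ![ξ, a, b, c]).det ^ 2 := by
    obtain ⟨η, t, hη, rfl⟩ : ∃ (η : Fin 4 → ℝ) (t : ℝ), η 0 = 1 ∧ ξ = t • η :=
      ⟨(ξ 0)⁻¹ • ξ, ξ 0, by simp [hξ], by simp [hξ]⟩
    have hdet (t : ℝ) : (of ![t • η, a, b, c]).det = t * (of ![η, a, b, c]).det := by
      simp only [det_fin_four, of_apply, cons_val, Pi.smul_apply, smul_eq_mul]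
      ring
    rw [gram3_smul, fresnel_smul, hdet, hone η hη]
    ring
  have hcont : Continuous fun ξ => fresnel κ ξ * (of ![ξ, a, b, c]).det ^ 2 := by
    refine (continuous_fresnel κ).mul (Continuous.pow ?_ 2)
    simp only [det_fin_four, of_apply, cons_val]
    fun_prop
  have hline : Continuous fun t : ℝ => ξ + t • ![1, 0, 0, 0] := by fun_prop
  have hdense : Dense {t : ℝ | t ≠ -ξ 0} := dense_compl_singleton (-ξ 0)
  have := ((continuous_gram3 _ a b c).comp hline).ext_on hdense (hcont.comp hline) fun t ht =>
    hne _ fun h0 => ht (by simp at h0; linarith)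
  simpa only [Function.comp_apply, zero_smul, add_zero] using congrFun this 0

/-- The second compound matrix of `L`, in the ordering `O`. -/
def compound (L : Matrix (Fin 4) (Fin 4) ℝ) : Matrix (Fin 6) (Fin 6) ℝ :=
  of fun I => wedge (L (pairs I).1) (L (pairs I).2)

lemma wedge_vecMul (a b : Fin 4 → ℝ) (L : Matrix (Fin 4) (Fin 4) ℝ) :
    wedge (a ᵥ* L) (b ᵥ* L) = wedge a b ᵥ* compound L := by
  ext J
  fin_cases J <;> simp [wedge, vecMul, dotProduct, compound, pairs, Fin.sum_univ_succ] <;> ring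

lemma compound_mul (A B : Matrix (Fin 4) (Fin 4) ℝ) :
    compound (A * B) = compound A * compound B := by
  ext I J
  simpa [compound, mul_apply_eq_vecMul, vecMul, dotProduct, Matrix.mul_apply] using
    congrFun (wedge_vecMul (A (pairs I).1) (A (pairs I).2) B) J

lemma compound_transpose (L : Matrix (Fin 4) (Fin 4) ℝ) : compound Lᵀ = (compound L)ᵀ := by
  ext I J
  simp [compound, wedge]
  ring

lemma compound_one : compound 1 = 1 := by
  ext I J
  simp only [compound, of_apply, wedge, Matrix.one_apply]
  fin_cases I <;> fin_cases J <;> simp [pairs]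

lemma compound_smul (c : ℝ) (L : Matrix (Fin 4) (Fin 4) ℝ) :
    compound (c • L) = c ^ 2 • compound L := by
  ext I J
  simp [compound, wedge]
  ring

lemma wedge_dotProduct_wedgeMat (a b c d : Fin 4 → ℝ) :
    wedge a b ⬝ᵥ wedgeMat *ᵥ wedge c d = (of ![a, b, c, d]).det := by
  rw [det_fin_four]
  simp [dotProduct, mulVec, wedgeMat, Fin.sum_univ_succ, wedge, pairs]
  ring

lemma wedgeMat_mul_self : wedgeMat * wedgeMat = 1 := by
  ext I J
  fin_cases I <;> fin_cases J <;> simp [wedgeMat, Matrix.mul_apply, Fin.sum_univ_six]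

lemma wedgeMat_transpose : wedgeMatᵀ = wedgeMat := by
  ext I J
  fin_cases I <;> fin_cases J <;> simp [wedgeMat]

lemma compound_mul_wedgeMat_mul_transpose (L : Matrix (Fin 4) (Fin 4) ℝ) :
    compound L * wedgeMat * (compound L)ᵀ = L.det • wedgeMat := by
  have h (I J : Fin 6) : (compound L * wedgeMat * (compound L)ᵀ) I J =
      wedge (L (pairs I).1) (L (pairs I).2) ⬝ᵥ
        wedgeMat *ᵥ wedge (L (pairs J).1) (L (pairs J).2) := by
    rw [dotProduct_mulVec]
    rfl
  ext I J
  rw [h, wedge_dotProduct_wedgeMat, det_fin_four, det_fin_four]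
  fin_cases I <;> fin_cases J <;> simp [wedgeMat, pairs] <;> ring

lemma wedgeMat_mul_compound_sq {h : Matrix (Fin 4) (Fin 4) ℝ} (hh : h.IsSymm) :
    wedgeMat * compound h * (wedgeMat * compound h) = h.det • 1 := by
  have := compound_mul_wedgeMat_mul_transpose h
  rw [← compound_transpose, hh.eq] at this
  calc _ = wedgeMat * (compound h * wedgeMat * compound h) := by simp only [Matrix.mul_assoc]
    _ = _ := by rw [this, Matrix.mul_smul, wedgeMat_mul_self]

lemma gram3_compound (X : Matrix (Fin 6) (Fin 6) ℝ) (L : Matrix (Fin 4) (Fin 4) ℝ)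
    (ξ a b c : Fin 4 → ℝ) :
    gram3 (compound L * X * (compound L)ᵀ) ξ a b c =
      gram3 X (ξ ᵥ* L) (a ᵥ* L) (b ᵥ* L) (c ᵥ* L) := by
  have h (u v : Fin 4 → ℝ) : wedge ξ u ⬝ᵥ (compound L * X * (compound L)ᵀ) *ᵥ wedge ξ v =
      wedge (ξ ᵥ* L) (u ᵥ* L) ⬝ᵥ X *ᵥ wedge (ξ ᵥ* L) (v ᵥ* L) := by
    rw [wedge_vecMul, wedge_vecMul, ← mulVec_mulVec, ← mulVec_mulVec, mulVec_transpose,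
      dotProduct_mulVec]
  simp only [gram3, h]

lemma det_of_vecMul (ξ a b c : Fin 4 → ℝ) (L : Matrix (Fin 4) (Fin 4) ℝ) :
    (of ![ξ ᵥ* L, a ᵥ* L, b ᵥ* L, c ᵥ* L]).det = (of ![ξ, a, b, c]).det * L.det := by
  rw [← det_mul]
  congr 1
  ext i j
  fin_cases i <;> simp [Matrix.mul_apply, vecMul, dotProduct]

/-- The matrix of the quadratic form `ξ₀ ξ₃ - ξ₁² - ξ₂²`. -/
def nullForm : Matrix (Fin 4) (Fin 4) ℝ :=
  !![0, 0, 0, 1 / 2; 0, -1, 0, 0; 0, 0, -1, 0; 1 / 2, 0, 0, 0]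

lemma det_nullForm : nullForm.det = -1 / 4 := by
  simp [det_fin_four, nullForm]
  norm_num

lemma mul_diagonal_mul_transpose_apply (T : Matrix (Fin 4) (Fin 4) ℝ) (s : Fin 4 → ℝ)
    (i j : Fin 4) : (T * diagonal s * Tᵀ) i j = T i 0 * s 0 * T j 0 + T i 1 * s 1 * T j 1 +
      T i 2 * s 2 * T j 2 + T i 3 * s 3 * T j 3 := by
  simp [Matrix.mul_apply, Fin.sum_univ_four, diagonal_apply]

lemma exists_mul_diagonal_mul_transpose (s : Fin 4 → ℝ) (hs : ∀ i, s i = 1 ∨ s i = -1)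
    (hprod : ∏ i, s i < 0) :
    ∃ (ε : ℝ) (T : Matrix (Fin 4) (Fin 4) ℝ), ε ^ 2 = 1 ∧ T * diagonal s * Tᵀ = ε • nullForm := by
  have key (k : Fin 4) : ∃ T : Matrix (Fin 4) (Fin 4) ℝ, ∀ (ε : ℝ) (s : Fin 4 → ℝ),
      (∀ i, s i = if i = k then ε else -ε) → T * diagonal s * Tᵀ = ε • nullForm := by
    refine ⟨![!![1 / 2, 1 / 2, 0, 0; 0, 0, 1, 0; 0, 0, 0, 1; 1 / 2, -1 / 2, 0, 0],
      !![1 / 2, 1 / 2, 0, 0; 0, 0, 1, 0; 0, 0, 0, 1; -1 / 2, 1 / 2, 0, 0],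
      !![0, 1 / 2, 1 / 2, 0; 1, 0, 0, 0; 0, 0, 0, 1; 0, -1 / 2, 1 / 2, 0],
      !![0, 1 / 2, 0, 1 / 2; 0, 0, 1, 0; 1, 0, 0, 0; 0, -1 / 2, 0, 1 / 2]] k, fun ε s h => ?_⟩
    have h0 := h 0
    have h1 := h 1
    have h2 := h 2
    have h3 := h 3
    ext i j
    rw [mul_diagonal_mul_transpose_apply, h0, h1, h2, h3]
    fin_cases k <;> fin_cases i <;> fin_cases j <;> simp [nullForm] <;> ring
  rw [Fin.prod_univ_four] at hprod
  obtain ⟨ε, k, hε, h⟩ : ∃ (ε : ℝ) (k : Fin 4), ε ^ 2 = 1 ∧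
      ∀ i, s i = if i = k then ε else -ε := by
    rcases hs 0 with h0 | h0 <;> rcases hs 1 with h1 | h1 <;> rcases hs 2 with h2 | h2 <;>
      rcases hs 3 with h3 | h3 <;> norm_num [h0, h1, h2, h3] at hprod
    all_goals
      first
        | (refine ⟨1, 0, by norm_num, fun i => ?_⟩; fin_cases i <;> simp [h0, h1, h2, h3]; done)
        | (refine ⟨1, 1, by norm_num, fun i => ?_⟩; fin_cases i <;> simp [h0, h1, h2, h3]; done)
        | (refine ⟨1, 2, by norm_num, fun i => ?_⟩; fin_cases i <;> simp [h0, h1, h2, h3]; done)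
        | (refine ⟨1, 3, by norm_num, fun i => ?_⟩; fin_cases i <;> simp [h0, h1, h2, h3]; done)
        | (refine ⟨-1, 0, by norm_num, fun i => ?_⟩; fin_cases i <;> simp [h0, h1, h2, h3]; done)
        | (refine ⟨-1, 1, by norm_num, fun i => ?_⟩; fin_cases i <;> simp [h0, h1, h2, h3]; done)
        | (refine ⟨-1, 2, by norm_num, fun i => ?_⟩; fin_cases i <;> simp [h0, h1, h2, h3]; done)
        | refine ⟨-1, 3, by norm_num, fun i => ?_⟩; fin_cases i <;> simp [h0, h1, h2, h3]
  obtain ⟨T, hT⟩ := key k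
  exact ⟨ε, T, hε, hT ε s h⟩

lemma exists_mul_mul_transpose_eq_nullForm {h : Matrix (Fin 4) (Fin 4) ℝ} (hh : h.IsSymm)
    (hdet : h.det < 0) :
    ∃ (ε : ℝ) (L : Matrix (Fin 4) (Fin 4) ℝ), ε ^ 2 = 1 ∧ L * h * Lᵀ = ε • nullForm := by
  have hH : h.IsHermitian := by rw [IsHermitian, conjTranspose_eq_transpose_of_trivial, hh.eq]
  have hprod := hH.det_eq_prod_eigenvalues
  have hdiag := hH.conjStarAlgAut_star_eigenvectorUnitary
  set U : Matrix (Fin 4) (Fin 4) ℝ := hH.eigenvectorUnitary.1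
  rw [Unitary.conjStarAlgAut_star_apply] at hdiag
  set d := hH.eigenvalues
  have hne (i) : d i ≠ 0 := fun hi => by
    rw [hprod, Finset.prod_eq_zero (Finset.mem_univ i) (by simp [hi])] at hdet
    exact lt_irrefl _ hdet
  obtain ⟨c, hc, hcd⟩ : ∃ c : Fin 4 → ℝ, (∀ i, c i ≠ 0) ∧
      ∀ i, c i * d i * c i = 1 ∨ c i * d i * c i = -1 := by
    refine ⟨fun i => (Real.sqrt |d i|)⁻¹, fun i => ?_, fun i => ?_⟩
    · simpa using (Real.sqrt_pos.2 (abs_pos.2 (hne i))).ne'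
    · have h1 : (Real.sqrt |d i|)⁻¹ * d i * (Real.sqrt |d i|)⁻¹ = d i / |d i| := by
        conv_rhs => rw [← Real.mul_self_sqrt (abs_nonneg (d i))]
        have := (Real.sqrt_pos.2 (abs_pos.2 (hne i))).ne'
        field_simp
      simp only [h1]
      rcases lt_or_gt_of_ne (hne i) with hi | hi
      · right; rw [abs_of_neg hi, div_neg, div_self hi.ne]
      · left; rw [abs_of_pos hi, div_self hi.ne']
  obtain ⟨ε, T, hε, hT⟩ := exists_mul_diagonal_mul_transpose (fun i => c i * d i * c i) hcd (by
    have : ∏ i, c i * d i * c i = (∏ i, c i) ^ 2 * ∏ i, d i := by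
      rw [sq, Finset.prod_mul_distrib, Finset.prod_mul_distrib]; ring
    rw [this]
    refine mul_neg_of_pos_of_neg (sq_pos_of_ne_zero (Finset.prod_ne_zero_iff.2 fun i _ => hc i)) ?_
    simpa [hprod] using hdet)
  refine ⟨ε, T * diagonal c * star U, hε, ?_⟩
  rw [← hT, transpose_mul, transpose_mul, diagonal_transpose, star_eq_conjTranspose,
    conjTranspose_eq_transpose_of_trivial, transpose_transpose]
  have hd : diagonal (fun i => c i * d i * c i) = diagonal c * diagonal d * diagonal c := by
    simp [diagonal_mul_diagonal]
  rw [hd, ← show Uᵀ * h * U = diagonal d by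
    rw [← conjTranspose_eq_transpose_of_trivial]; exact hdiag]
  simp only [Matrix.mul_assoc]

lemma exists_smul_add_smul_eq_zero_of_nullForm (u v : Fin 4 → ℝ)
    (huu : u ⬝ᵥ nullForm *ᵥ u = 0) (huv : u ⬝ᵥ nullForm *ᵥ v = 0)
    (hvv : v ⬝ᵥ nullForm *ᵥ v = 0) : ∃ s t : ℝ, (s ≠ 0 ∨ t ≠ 0) ∧ s • u + t • v = 0 := by
  have hform (a b : Fin 4 → ℝ) : a ⬝ᵥ nullForm *ᵥ b =
      (a 0 * b 3 + a 3 * b 0) / 2 - a 1 * b 1 - a 2 * b 2 := by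
    simp [nullForm, dotProduct, mulVec, Fin.sum_univ_succ]
    ring
  have key (z : Fin 4 → ℝ) (hz : z ⬝ᵥ nullForm *ᵥ z = 0) (hz0 : z 0 = 0) : z 1 = 0 ∧ z 2 = 0 := by
    rw [hform, hz0] at hz
    constructor <;> nlinarith [sq_nonneg (z 1), sq_nonneg (z 2)]
  rw [hform] at huu huv hvv
  by_cases h0 : u 0 = 0 ∧ v 0 = 0
  · obtain ⟨hu1, hu2⟩ := key u (by rw [hform]; exact huu) h0.1
    obtain ⟨hv1, hv2⟩ := key v (by rw [hform]; exact hvv) h0.2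
    by_cases hu3 : u 3 = 0
    · refine ⟨1, 0, by simp, ?_⟩
      ext i
      fin_cases i <;> simp [h0, hu1, hu2, hu3]
    · refine ⟨v 3, -u 3, by simp [hu3], ?_⟩
      ext i
      fin_cases i <;> simp [h0, hu1, hu2, hv1, hv2]
      ring
  · have hz : (v 0 • u - u 0 • v) ⬝ᵥ nullForm *ᵥ (v 0 • u - u 0 • v) = 0 := by
      rw [hform]
      simp only [Pi.sub_apply, Pi.smul_apply, smul_eq_mul]
      linear_combination v 0 ^ 2 * huu - 2 * u 0 * v 0 * huv + u 0 ^ 2 * hvv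
    obtain ⟨h1, h2⟩ := key _ hz (by simp; ring)
    have h3 : v 0 * u 3 - u 0 * v 3 = 0 := by
      simp only [Pi.sub_apply, Pi.smul_apply, smul_eq_mul] at h1 h2
      have hu : u 0 * (v 0 * u 3 - u 0 * v 3) = 0 := by
        linear_combination 2 * (v 0 * huu - u 0 * huv) + 2 * u 1 * h1 + 2 * u 2 * h2
      have hv : v 0 * (v 0 * u 3 - u 0 * v 3) = 0 := by
        linear_combination 2 * (v 0 * huv - u 0 * hvv) + 2 * v 1 * h1 + 2 * v 2 * h2
      by_contra hne
      exact h0 ⟨(mul_eq_zero.1 hu).resolve_right hne, (mul_eq_zero.1 hv).resolve_right hne⟩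
    refine ⟨v 0, -u 0, ?_, ?_⟩
    · by_contra! h
      exact h0 ⟨by linarith [h.2], h.1⟩
    · simp only [Pi.sub_apply, Pi.smul_apply, smul_eq_mul] at h1 h2
      ext i
      fin_cases i <;> simp <;> linarith

lemma exists_smul_add_smul_eq_zero {h : Matrix (Fin 4) (Fin 4) ℝ} (hh : h.IsSymm)
    (hdet : h.det < 0) (u v : Fin 4 → ℝ) (huu : u ⬝ᵥ h *ᵥ u = 0) (huv : u ⬝ᵥ h *ᵥ v = 0)
    (hvv : v ⬝ᵥ h *ᵥ v = 0) : ∃ s t : ℝ, (s ≠ 0 ∨ t ≠ 0) ∧ s • u + t • v = 0 := by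
  obtain ⟨ε, L, hε, hL⟩ := exists_mul_mul_transpose_eq_nullForm hh hdet
  have hε0 : ε ≠ 0 := by rintro rfl; norm_num at hε
  have hLdet : IsUnit L.det := by
    refine isUnit_iff_ne_zero.2 fun h0 => ?_
    have := congrArg det hL
    rw [det_mul, det_mul, h0, det_smul, det_nullForm] at this
    simp [hε0] at this
  have hsurj (a : Fin 4 → ℝ) : (a ᵥ* L⁻¹) ᵥ* L = a := by
    rw [vecMul_vecMul, nonsing_inv_mul _ hLdet, vecMul_one]
  have hform (a b : Fin 4 → ℝ) : (a ᵥ* L) ⬝ᵥ h *ᵥ (b ᵥ* L) = ε * (a ⬝ᵥ nullForm *ᵥ b) := by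
    rw [← smul_eq_mul, ← dotProduct_smul, ← smul_mulVec, ← hL, ← mulVec_mulVec, ← mulVec_mulVec,
      mulVec_transpose, dotProduct_mulVec a L]
  rw [← hsurj u] at huu huv ⊢
  rw [← hsurj v] at hvv huv ⊢
  rw [hform] at huu huv hvv
  obtain ⟨s, t, hst, h0⟩ := exists_smul_add_smul_eq_zero_of_nullForm _ _
    ((mul_eq_zero.1 huu).resolve_left hε0) ((mul_eq_zero.1 huv).resolve_left hε0)
    ((mul_eq_zero.1 hvv).resolve_left hε0)
  refine ⟨s, t, hst, ?_⟩
  simpa only [add_vecMul, smul_vecMul, zero_vecMul] using congrArg (· ᵥ* L) h0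

lemma binary_quadratic_eq_zero_or_eq_zero (a b c a' b' c' : ℝ)
    (h : ∀ s t : ℝ, (a * s ^ 2 + 2 * b * s * t + c * t ^ 2) *
      (a' * s ^ 2 + 2 * b' * s * t + c' * t ^ 2) = 0) :
    (a = 0 ∧ b = 0 ∧ c = 0) ∨ (a' = 0 ∧ b' = 0 ∧ c' = 0) := by
  have e1 := h 1 0
  have e2 := h 0 1
  have e3 := h 1 1
  have e4 := h 1 (-1)
  have e5 := h 1 2
  have h1 : a * a' = 0 := by linarith
  have h2 : c * c' = 0 := by linarith
  have h3 : a * c' + c * a' + 4 * b * b' = 0 := by linarith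
  have h4 : a * b' + b * a' = 0 := by linarith
  have h5 : b * c' + c * b' = 0 := by linarith
  by_cases ha : a = 0
  · by_cases hc : c = 0
    · by_cases hb : b = 0
      · exact Or.inl ⟨ha, hb, hc⟩
      · simp_all
    · simp_all
  · simp_all

lemma mem_nullCone_iff (g : Matrix (Fin 4) (Fin 4) ℝ) (ξ : Fin 4 → ℝ) :
    ξ ∈ nullCone g ↔ ξ ⬝ᵥ g⁻¹ *ᵥ ξ = 0 := by
  simp only [nullCone, Set.mem_ofPred_eq, dotProduct, mulVec, Finset.mul_sum]
  refine Eq.congr (Finset.sum_congr rfl fun _ _ => Finset.sum_congr rfl fun _ _ => ?_) rfl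
  ring

lemma IsLorentz.inv {g : Matrix (Fin 4) (Fin 4) ℝ} (hg : IsLorentz g) : IsLorentz g⁻¹ := by
  refine ⟨?_, ?_⟩
  · rw [Matrix.IsSymm, transpose_nonsing_inv, hg.1.eq]
  · rw [det_nonsing_inv, Ring.inverse_eq_inv]
    exact inv_lt_zero.2 hg.2

lemma exists_smul_add_smul_eq_zero_of_subset {gp gm : Matrix (Fin 4) (Fin 4) ℝ}
    (hgp : IsLorentz gp) (hgm : IsLorentz gm) (u v : Fin 4 → ℝ)
    (h : ∀ s t : ℝ, s • u + t • v ∈ nullCone gp ∪ nullCone gm) :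
    ∃ s t : ℝ, (s ≠ 0 ∨ t ≠ 0) ∧ s • u + t • v = 0 := by
  have hexp {g : Matrix (Fin 4) (Fin 4) ℝ} (hg : IsLorentz g) (s t : ℝ) :
      (s • u + t • v) ⬝ᵥ g⁻¹ *ᵥ (s • u + t • v) = (u ⬝ᵥ g⁻¹ *ᵥ u) * s ^ 2 +
        2 * (u ⬝ᵥ g⁻¹ *ᵥ v) * s * t + (v ⬝ᵥ g⁻¹ *ᵥ v) * t ^ 2 := by
    have hsymm : v ⬝ᵥ g⁻¹ *ᵥ u = u ⬝ᵥ g⁻¹ *ᵥ v := by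
      rw [dotProduct_mulVec, ← mulVec_transpose, hg.inv.1.eq, dotProduct_comm]
    simp only [mulVec_add, mulVec_smul, dotProduct_add, add_dotProduct, dotProduct_smul,
      smul_dotProduct, smul_eq_mul, hsymm]
    ring
  have hmul (s t : ℝ) : (s • u + t • v) ⬝ᵥ gp⁻¹ *ᵥ (s • u + t • v) *
      ((s • u + t • v) ⬝ᵥ gm⁻¹ *ᵥ (s • u + t • v)) = 0 := by
    rw [mul_eq_zero, ← mem_nullCone_iff, ← mem_nullCone_iff]
    exact h s t
  simp only [hexp hgp, hexp hgm] at hmul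
  rcases binary_quadratic_eq_zero_or_eq_zero _ _ _ _ _ _ hmul with ⟨h1, h2, h3⟩ | ⟨h1, h2, h3⟩
  · exact exists_smul_add_smul_eq_zero hgp.inv.1 hgp.inv.2 u v h1 h2 h3
  · exact exists_smul_add_smul_eq_zero hgm.inv.1 hgm.inv.2 u v h1 h2 h3

lemma hasDerivAt_dotProduct_mulVec (Y : Matrix (Fin 6) (Fin 6) ℝ) {U V : ℝ → Fin 6 → ℝ}
    {U' V' : Fin 6 → ℝ} {t : ℝ} (hU : ∀ I, HasDerivAt (fun s => U s I) (U' I) t)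
    (hV : ∀ I, HasDerivAt (fun s => V s I) (V' I) t) :
    HasDerivAt (fun s => U s ⬝ᵥ Y *ᵥ V s) (U' ⬝ᵥ Y *ᵥ V t + U t ⬝ᵥ Y *ᵥ V') t := by
  simp only [dotProduct, mulVec, ← Finset.sum_add_distrib]
  exact HasDerivAt.fun_sum fun I _ => (hU I).mul
    (HasDerivAt.fun_sum fun J _ => (hV J).const_mul (Y I J))

lemma hasDerivAt_wedge {z : ℝ → Fin 4 → ℝ} {w : Fin 4 → ℝ} {t : ℝ}
    (hz : ∀ i, HasDerivAt (fun s => z s i) (w i) t) (a : Fin 4 → ℝ) (I : Fin 6) :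
    HasDerivAt (fun s => wedge (z s) a I) (wedge w a I) t :=
  ((hz _).mul_const _).sub ((hz _).mul_const _)

/-- The derivatives of the Gram determinant at `(1, 0, 0, 0)` in the last three coordinate
directions, for a symmetric form whose determinant on the screen is zero. -/
def gramGrad (Y : Matrix (Fin 6) (Fin 6) ℝ) : Fin 3 → ℝ :=
  let n₁₁ := Y 1 1 * Y 2 2 - Y 1 2 ^ 2
  let n₁₂ := Y 0 2 * Y 1 2 - Y 0 1 * Y 2 2
  let n₁₃ := Y 0 1 * Y 1 2 - Y 0 2 * Y 1 1
  let n₂₂ := Y 0 0 * Y 2 2 - Y 0 2 ^ 2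
  let n₂₃ := Y 0 1 * Y 0 2 - Y 0 0 * Y 1 2
  let n₃₃ := Y 0 0 * Y 1 1 - Y 0 1 ^ 2
  ![2 * (n₁₂ * Y 5 0 + n₂₂ * Y 5 1 + n₂₃ * Y 5 2) - 2 * (n₁₃ * Y 4 0 + n₂₃ * Y 4 1 + n₃₃ * Y 4 2),
    2 * (n₁₃ * Y 3 0 + n₂₃ * Y 3 1 + n₃₃ * Y 3 2) - 2 * (n₁₁ * Y 5 0 + n₁₂ * Y 5 1 + n₁₃ * Y 5 2),
    2 * (n₁₁ * Y 4 0 + n₁₂ * Y 4 1 + n₁₃ * Y 4 2) - 2 * (n₁₂ * Y 3 0 + n₂₂ * Y 3 1 + n₂₃ * Y 3 2)]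

lemma hasDerivAt_gram3 {Y : Matrix (Fin 6) (Fin 6) ℝ} (hY : Y.IsSymm)
    (hdet : gram3 Y ![1, 0, 0, 0] ![0, 1, 0, 0] ![0, 0, 1, 0] ![0, 0, 0, 1] = 0)
    {z : ℝ → Fin 4 → ℝ} {w : Fin 4 → ℝ} (hz0 : z 0 = ![1, 0, 0, 0])
    (hz : ∀ i, HasDerivAt (fun s => z s i) (w i) 0) :
    HasDerivAt (fun t => gram3 Y (z t) ![0, 1, 0, 0] ![0, 0, 1, 0] ![0, 0, 0, 1])
      (w 1 * gramGrad Y 0 + w 2 * gramGrad Y 1 + w 3 * gramGrad Y 2) 0 := by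
  have e (i j : Fin 6) : Y j i = Y i j := hY.apply i j
  have hd (a b : Fin 4 → ℝ) :=
    hasDerivAt_dotProduct_mulVec Y (hasDerivAt_wedge hz a) (hasDerivAt_wedge hz b)
  have hmul {f₁ f₂ f₃ : ℝ → ℝ} {d₁ d₂ d₃ : ℝ} (h₁ : HasDerivAt f₁ d₁ 0) (h₂ : HasDerivAt f₂ d₂ 0)
      (h₃ : HasDerivAt f₃ d₃ 0) := (h₁.fun_mul h₂).fun_mul h₃
  set e₁ : Fin 4 → ℝ := ![0, 1, 0, 0] with he₁
  set e₂ : Fin 4 → ℝ := ![0, 0, 1, 0] with he₂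
  set e₃ : Fin 4 → ℝ := ![0, 0, 0, 1] with he₃
  have hval (u : Fin 4 → ℝ) : wedge u e₁ = ![u 0, 0, 0, 0, u 3, -u 2] ∧
      wedge u e₂ = ![0, u 0, 0, -u 3, 0, u 1] ∧ wedge u e₃ = ![0, 0, u 0, u 2, -u 1, 0] := by
    refine ⟨?_, ?_, ?_⟩ <;> ext I <;> fin_cases I <;> simp [wedge, pairs, he₁, he₂, he₃]
  have hform (u v : Fin 6 → ℝ) : u ⬝ᵥ Y *ᵥ v = ∑ I, ∑ J, u I * Y I J * v J := by
    simp only [dotProduct, mulVec, Finset.mul_sum, mul_assoc]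
  simp only [gram3, det_fin_three, of_apply, cons_val] at hdet ⊢
  refine (((((hmul (hd e₁ e₁) (hd e₂ e₂) (hd e₃ e₃)).fun_sub
    (hmul (hd e₁ e₁) (hd e₂ e₃) (hd e₃ e₂))).fun_sub
    (hmul (hd e₁ e₂) (hd e₂ e₁) (hd e₃ e₃))).fun_add
    (hmul (hd e₁ e₂) (hd e₂ e₃) (hd e₃ e₁))).fun_add
    (hmul (hd e₁ e₃) (hd e₂ e₁) (hd e₃ e₂))).fun_sub
    (hmul (hd e₁ e₃) (hd e₂ e₂) (hd e₃ e₁)) |>.congr_deriv ?_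
  simp only [hz0, hval] at hdet ⊢
  simp only [hform, Fin.sum_univ_six, cons_val, e 0 1, e 0 2, e 0 3, e 0 4, e 0 5, e 1 2, e 1 3,
    e 1 4, e 1 5, e 2 3, e 2 4, e 2 5, e 3 4, e 3 5, e 4 5, gramGrad, mul_zero, zero_mul, add_zero,
    zero_add, mul_one, one_mul] at hdet ⊢
  linear_combination 6 * w 0 * hdet

lemma gramGrad_eq_zero {Y : Matrix (Fin 6) (Fin 6) ℝ} (hY : Y.IsSymm)
    (hnull : ∀ z : Fin 4 → ℝ, z 0 * z 3 = z 1 ^ 2 + z 2 ^ 2 →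
      gram3 Y z ![0, 1, 0, 0] ![0, 0, 1, 0] ![0, 0, 0, 1] = 0) :
    gramGrad Y 0 = 0 ∧ gramGrad Y 1 = 0 := by
  have hdet := hnull ![1, 0, 0, 0] (by simp)
  have hpow : HasDerivAt (fun t : ℝ => t ^ 2) 0 0 := by simpa using hasDerivAt_pow 2 (0 : ℝ)
  have hzero (z : ℝ → Fin 4 → ℝ) (hz : ∀ t, z t 0 * z t 3 = z t 1 ^ 2 + z t 2 ^ 2) {d : ℝ}
      (h : HasDerivAt (fun t => gram3 Y (z t) ![0, 1, 0, 0] ![0, 0, 1, 0] ![0, 0, 0, 1]) d 0) :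
      d = 0 := by
    simp only [fun t => hnull (z t) (hz t)] at h
    exact h.unique (hasDerivAt_const _ _)
  have h₁ := hzero (fun t => ![1, t, 0, t ^ 2]) (by simp) (hasDerivAt_gram3 hY hdet
    (w := ![0, 1, 0, 0]) (by simp) fun i => by
      fin_cases i
      exacts [hasDerivAt_const _ _, hasDerivAt_id _, hasDerivAt_const _ _, hpow])
  have h₂ := hzero (fun t => ![1, 0, t, t ^ 2]) (by simp) (hasDerivAt_gram3 hY hdet
    (w := ![0, 0, 1, 0]) (by simp) fun i => by
      fin_cases i
      exacts [hasDerivAt_const _ _, hasDerivAt_const _ _, hasDerivAt_id _, hpow])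
  simp only [cons_val, zero_mul, one_mul, zero_add, add_zero] at h₁ h₂
  exact ⟨h₁, h₂⟩

lemma screen_mul_gramGrad {Y : Matrix (Fin 6) (Fin 6) ℝ} (hY : Y.IsSymm)
    (hnull : ∀ z : Fin 4 → ℝ, z 0 * z 3 = z 1 ^ 2 + z 2 ^ 2 →
      gram3 Y z ![0, 1, 0, 0] ![0, 0, 1, 0] ![0, 0, 0, 1] = 0) :
    (Y 0 0 * Y 1 1 - Y 0 1 ^ 2) * gramGrad Y 2 = 0 := by
  have e (i j : Fin 6) : Y j i = Y i j := hY.apply i j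
  obtain ⟨h₁, h₂⟩ := gramGrad_eq_zero hY hnull
  have hA : Y 0 0 * (Y 1 1 * Y 2 2 - Y 1 2 ^ 2) + Y 0 1 * (Y 0 2 * Y 1 2 - Y 0 1 * Y 2 2) +
      Y 0 2 * (Y 0 1 * Y 1 2 - Y 0 2 * Y 1 1) = 0 := by
    rw [← hnull ![1, 0, 0, 0] (by simp)]
    simp [gram3, det_fin_three, wedge, pairs, dotProduct, mulVec, Fin.sum_univ_succ, e 0 1, e 0 2,
      e 1 2]
    ring
  simp only [gramGrad, cons_val] at h₁ h₂ ⊢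
  linear_combination 2 * (Y 5 0 * Y 1 2 - Y 5 1 * Y 0 2 + Y 4 0 * Y 1 1 - Y 4 1 * Y 0 1 +
    Y 3 0 * Y 0 1 - Y 3 1 * Y 0 0) * hA - (Y 0 1 * Y 1 2 - Y 0 2 * Y 1 1) * h₁ -
    (Y 0 1 * Y 0 2 - Y 0 0 * Y 1 2) * h₂

/-- A frame whose first vector is the point `(1, x, y, x² + y²)` of the null cone of `nullForm`,
and which preserves this form. -/
def nullFrame (x y : ℝ) : Matrix (Fin 4) (Fin 4) ℝ :=
  !![1, x, y, x ^ 2 + y ^ 2; 0, 1, 0, 2 * x; 0, 0, 1, 2 * y; 0, 0, 0, 1]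

lemma det_nullFrame (x y : ℝ) : (nullFrame x y).det = 1 := by
  simp [det_fin_four, nullFrame]

lemma vecMul_nullFrame (x y : ℝ) (z : Fin 4 → ℝ) :
    z ᵥ* nullFrame x y = ![z 0, z 0 * x + z 1, z 0 * y + z 2,
      z 0 * (x ^ 2 + y ^ 2) + z 1 * (2 * x) + z 2 * (2 * y) + z 3] := by
  ext i
  fin_cases i <;> simp [nullFrame, vecMul, dotProduct, Fin.sum_univ_four]

/-- The form `X` expressed in the null frame at `(x, y)`. -/
def framedForm (X : Matrix (Fin 6) (Fin 6) ℝ) (x y : ℝ) : Matrix (Fin 6) (Fin 6) ℝ :=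
  compound (nullFrame x y) * X * (compound (nullFrame x y))ᵀ

lemma isSymm_framedForm {X : Matrix (Fin 6) (Fin 6) ℝ} (hX : X.IsSymm) (x y : ℝ) :
    (framedForm X x y).IsSymm := by
  simp [framedForm, Matrix.IsSymm, transpose_mul, hX.eq, Matrix.mul_assoc]

/-- The form with matrix `X` has Gram determinants given by the function `g`. -/
def HasGram (X : Matrix (Fin 6) (Fin 6) ℝ) (g : (Fin 4 → ℝ) → ℝ) : Prop :=
  ∀ ξ a b c, gram3 X ξ a b c = g ξ * (of ![ξ, a, b, c]).det ^ 2

lemma HasGram.framed {X : Matrix (Fin 6) (Fin 6) ℝ} {g : (Fin 4 → ℝ) → ℝ} (h : HasGram X g)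
    (x y : ℝ) (z : Fin 4 → ℝ) :
    gram3 (framedForm X x y) z ![0, 1, 0, 0] ![0, 0, 1, 0] ![0, 0, 0, 1] =
      g (z ᵥ* nullFrame x y) * z 0 ^ 2 := by
  rw [framedForm, gram3_compound, h, det_of_vecMul, det_nullFrame, mul_one]
  simp [det_fin_four]

lemma HasGram.framed_eq_zero {X : Matrix (Fin 6) (Fin 6) ℝ} {g : (Fin 4 → ℝ) → ℝ}
    (h : HasGram X g) (hg : ∀ ξ : Fin 4 → ℝ, ξ 0 * ξ 3 = ξ 1 ^ 2 + ξ 2 ^ 2 → g ξ = 0) (x y : ℝ)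
    (z : Fin 4 → ℝ) (hz : z 0 * z 3 = z 1 ^ 2 + z 2 ^ 2) :
    gram3 (framedForm X x y) z ![0, 1, 0, 0] ![0, 0, 1, 0] ![0, 0, 0, 1] = 0 := by
  rw [h.framed, hg, zero_mul]
  simp only [vecMul_nullFrame, cons_val]
  linear_combination hz

/-- The coefficient of `s³ t` in the restriction of `g` to a line through a null point. -/
lemma coeff_eq_zero {X : Matrix (Fin 6) (Fin 6) ℝ} (hX : X.IsSymm) {g : (Fin 4 → ℝ) → ℝ}
    (h : HasGram X g) (hg : ∀ ξ : Fin 4 → ℝ, ξ 0 * ξ 3 = ξ 1 ^ 2 + ξ 2 ^ 2 → g ξ = 0) {x y : ℝ}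
    (hR : gramGrad (framedForm X x y) 2 = 0) (v : Fin 4 → ℝ) (c : Fin 5 → ℝ)
    (hc : ∀ t : ℝ, g (![1, x, y, x ^ 2 + y ^ 2] + t • v) =
      c 0 + c 1 * t + c 2 * t ^ 2 + c 3 * t ^ 3 + c 4 * t ^ 4) : c 1 = 0 := by
  have hY := isSymm_framedForm hX x y
  have hnull := h.framed_eq_zero hg x y
  obtain ⟨h₁, h₂⟩ := gramGrad_eq_zero hY hnull
  have hc0 : c 0 = 0 := by
    have := hc 0
    rw [hg] at this
    · simpa using this.symm
    · simp
  have hd := hasDerivAt_gram3 hY (hnull _ (by simp))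
    (z := fun t => ![1, 0, 0, 0] + t • (v ᵥ* nullFrame (-x) (-y)))
    (w := v ᵥ* nullFrame (-x) (-y)) (by simp) fun i => by
      simpa using (hasDerivAt_id (0 : ℝ)).mul_const ((v ᵥ* nullFrame (-x) (-y)) i)
  simp only [h₁, h₂, hR, mul_zero, add_zero, h.framed] at hd
  have hv (t : ℝ) : (![1, 0, 0, 0] + t • (v ᵥ* nullFrame (-x) (-y))) ᵥ* nullFrame x y =
      ![1, x, y, x ^ 2 + y ^ 2] + t • v := by
    simp only [vecMul_nullFrame]
    ext i
    fin_cases i <;> simp <;> ring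
  simp only [hv, hc, hc0] at hd
  have hid := hasDerivAt_id (0 : ℝ)
  have hp := ((((hid.const_mul (c 1)).const_add 0).fun_add ((hid.pow 2).const_mul (c 2))).fun_add
    ((hid.pow 3).const_mul (c 3))).fun_add ((hid.pow 4).const_mul (c 4)) |>.fun_mul
    (((hid.mul_const (v 0)).const_add 1).pow 2)
  refine (hp.congr_deriv ?_).unique (hd.congr_of_eventuallyEq ?_)
  · simp
  · refine Filter.Eventually.of_forall fun t => ?_
    simp [vecMul_nullFrame]

/-- The restriction of `g` to every plane is a binary quartic form. -/
def IsQuartic (g : (Fin 4 → ℝ) → ℝ) : Prop :=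
  ∀ u v, ∃ c : Fin 5 → ℝ, ∀ s t : ℝ, g (s • u + t • v) =
    c 0 * s ^ 4 + c 1 * s ^ 3 * t + c 2 * s ^ 2 * t ^ 2 + c 3 * s * t ^ 3 + c 4 * t ^ 4

lemma exists_null_shift {ξ : Fin 4 → ℝ} (hξ : ξ 0 * ξ 3 - ξ 1 ^ 2 - ξ 2 ^ 2 ≠ 0) :
    ∃ x y k : ℝ, k ≠ 0 ∧ k = ξ 3 + ξ 0 * (x ^ 2 + y ^ 2) - 2 * ξ 1 * x - 2 * ξ 2 * y ∧
      ξ 0 - (ξ 0 * ξ 3 - ξ 1 ^ 2 - ξ 2 ^ 2) / k ≠ 0 := by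
  by_cases h0 : ξ 0 = 0
  · have hbc : ξ 1 ^ 2 + ξ 2 ^ 2 ≠ 0 := fun h => hξ (by rw [h0]; linear_combination -h)
    refine ⟨(ξ 3 - 1) / (2 * (ξ 1 ^ 2 + ξ 2 ^ 2)) * ξ 1,
      (ξ 3 - 1) / (2 * (ξ 1 ^ 2 + ξ 2 ^ 2)) * ξ 2, 1, one_ne_zero, ?_, ?_⟩
    · rw [h0]
      field_simp
      ring
    · rw [div_one, h0, zero_sub, neg_ne_zero]
      rwa [h0] at hξ
  · obtain ⟨r, hr, hrQ⟩ : ∃ r : ℝ, r ^ 2 ≠ 0 ∧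
        r ^ 2 + (ξ 0 * ξ 3 - ξ 1 ^ 2 - ξ 2 ^ 2) ≠ 0 := by
      by_cases h : 1 + (ξ 0 * ξ 3 - ξ 1 ^ 2 - ξ 2 ^ 2) = 0
      · exact ⟨2, by norm_num, fun h' => by linarith⟩
      · exact ⟨1, by norm_num, by simpa using h⟩
    have hk : ξ 0 * ((r ^ 2 + (ξ 0 * ξ 3 - ξ 1 ^ 2 - ξ 2 ^ 2)) / ξ 0) =
        r ^ 2 + (ξ 0 * ξ 3 - ξ 1 ^ 2 - ξ 2 ^ 2) := by field_simp
    refine ⟨(ξ 1 + r) / ξ 0, ξ 2 / ξ 0, (r ^ 2 + (ξ 0 * ξ 3 - ξ 1 ^ 2 - ξ 2 ^ 2)) / ξ 0,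
      div_ne_zero hrQ h0, by field_simp; ring, fun h => hr ?_⟩
    rw [sub_eq_zero, eq_div_iff (div_ne_zero hrQ h0), hk] at h
    linarith

lemma exists_gramGrad_ne_zero {X : Matrix (Fin 6) (Fin 6) ℝ} (hX : X.IsSymm)
    {g : (Fin 4 → ℝ) → ℝ} (h : HasGram X g) (hq : IsQuartic g)
    (hg : ∀ ξ : Fin 4 → ℝ, ξ 0 * ξ 3 = ξ 1 ^ 2 + ξ 2 ^ 2 → g ξ = 0)
    (hplane : ∀ u v : Fin 4 → ℝ, (∀ s t : ℝ, g (s • u + t • v) = 0) →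
      ∃ s t : ℝ, (s ≠ 0 ∨ t ≠ 0) ∧ s • u + t • v = 0)
    {ξ : Fin 4 → ℝ} (hgξ : g ξ = 0) (hξ : ξ 0 * ξ 3 - ξ 1 ^ 2 - ξ 2 ^ 2 ≠ 0) :
    ∃ x y, gramGrad (framedForm X x y) 2 ≠ 0 := by
  by_contra! hR
  obtain ⟨x, y, k, hk0, hk, hv0⟩ := exists_null_shift hξ
  obtain ⟨τ, hτ⟩ : ∃ τ, τ = (ξ 0 * ξ 3 - ξ 1 ^ 2 - ξ 2 ^ 2) / k := ⟨_, rfl⟩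
  have hτ0 : τ ≠ 0 := hτ ▸ div_ne_zero hξ hk0
  have hτk : τ * k = ξ 0 * ξ 3 - ξ 1 ^ 2 - ξ 2 ^ 2 := hτ ▸ div_mul_cancel₀ _ hk0
  rw [← hτ] at hv0
  obtain ⟨ν, hν⟩ : ∃ ν : Fin 4 → ℝ, ν = ![1, x, y, x ^ 2 + y ^ 2] := ⟨_, rfl⟩
  obtain ⟨v, hv⟩ : ∃ v, v = ξ - τ • ν := ⟨_, rfl⟩
  have hξv : ξ = τ • ν + (1 : ℝ) • v := by simp [hv]
  replace hv0 : v 0 ≠ 0 := by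
    simpa only [hv, hν, Pi.sub_apply, Pi.smul_apply, smul_eq_mul, cons_val, mul_one] using hv0
  have hvnull : v 0 * v 3 = v 1 ^ 2 + v 2 ^ 2 := by
    simp only [hv, hν, Pi.sub_apply, Pi.smul_apply, smul_eq_mul, cons_val]
    linear_combination -hτk + τ * hk
  have hvν : (v 0)⁻¹ • v = ![1, v 1 / v 0, v 2 / v 0, (v 1 / v 0) ^ 2 + (v 2 / v 0) ^ 2] := by
    ext i
    fin_cases i <;> simp <;> field_simp
    linear_combination hvnull
  obtain ⟨c, hc⟩ := hq ν v
  have hc0 : c 0 = 0 := by simpa [hg ν (by simp [hν])] using (hc 1 0).symm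
  have hc4 : c 4 = 0 := by simpa [hg v hvnull] using (hc 0 1).symm
  have hc1 : c 1 = 0 := coeff_eq_zero hX h hg (hR x y) v c fun t => by
    simpa [hν] using hc 1 t
  have hc3 : c 3 = 0 := by
    have := coeff_eq_zero hX h hg (hR (v 1 / v 0) (v 2 / v 0)) ν
      ![c 4 * (v 0)⁻¹ ^ 4, c 3 * (v 0)⁻¹ ^ 3, c 2 * (v 0)⁻¹ ^ 2, c 1 * (v 0)⁻¹, c 0] fun t => by
        rw [← hvν, add_comm, hc]
        simp only [cons_val]
        ring
    simpa [hv0] using this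
  have hc2 : c 2 = 0 := by
    have := hc τ 1
    rw [← hξv, hgξ] at this
    simpa [hc0, hc1, hc3, hc4, hτ0] using this
  obtain ⟨s, t, hst, hsum⟩ := hplane ν v fun s t => by simp [hc, hc0, hc1, hc2, hc3, hc4]
  have hsξ : s • ν + t • (ξ - τ • ν) = 0 := hv ▸ hsum
  have e (i : Fin 4) : (s - t * τ) * ν i + t * ξ i = 0 := by
    have := congrFun hsξ i
    simp only [Pi.add_apply, Pi.smul_apply, Pi.sub_apply, smul_eq_mul, Pi.zero_apply] at this
    linear_combination this
  have e0 := e 0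
  have e1 := e 1
  have e2 := e 2
  have e3 := e 3
  simp only [hν, cons_val] at e0 e1 e2 e3
  obtain rfl | ht := eq_or_ne t 0
  · simp at hst e0
    exact hst e0
  · refine hξ (mul_left_cancel₀ (pow_ne_zero 2 ht) ?_)
    rw [show t ^ 2 * (ξ 0 * ξ 3 - ξ 1 ^ 2 - ξ 2 ^ 2) =
      (t * ξ 0) * (t * ξ 3) - (t * ξ 1) ^ 2 - (t * ξ 2) ^ 2 by ring, eq_neg_of_add_eq_zero_right e0,
      eq_neg_of_add_eq_zero_right e1, eq_neg_of_add_eq_zero_right e2,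
      eq_neg_of_add_eq_zero_right e3]
    ring

lemma eq_zero_of_mul_eq_zero_of_analyticOnNhd {𝕜 E : Type*} [NontriviallyNormedField 𝕜]
    [NormedAddCommGroup E] [NormedSpace 𝕜 E] [CompleteSpace 𝕜] [PreconnectedSpace E] {f g : E → 𝕜}
    (hf : AnalyticOnNhd 𝕜 f Set.univ) (hg : Continuous g) (hfg : ∀ p, f p * g p = 0) {p : E}
    (hp : g p ≠ 0) (q : E) : f q = 0 := by
  have h : f =ᶠ[nhds p] 0 := (hg.continuousAt.eventually_ne hp).mono fun z hz =>
    (mul_eq_zero.1 (hfg z)).resolve_right hz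
  exact hf.eqOn_zero_of_preconnected_of_eventuallyEq_zero isPreconnected_univ (Set.mem_univ p) h
    (Set.mem_univ q)

lemma eq_zero_of_forall_ofReal {f : ℂ → ℂ} (hf : Differentiable ℂ f) (h : ∀ x : ℝ, f x = 0)
    (z : ℂ) : f z = 0 := by
  have hn : AnalyticOnNhd ℂ f Set.univ := fun z _ => hf.analyticAt z
  refine hn.eqOn_zero_of_preconnected_of_frequently_eq_zero isPreconnected_univ (Set.mem_univ 0)
    ?_ (Set.mem_univ z)
  have ht : Filter.Tendsto (fun x : ℝ => (x : ℂ)) (nhdsWithin 0 {0}ᶜ) (nhdsWithin 0 {0}ᶜ) :=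
    Complex.continuous_ofReal.continuousWithinAt.tendsto_nhdsWithin fun x hx => by simpa using hx
  exact ht.frequently (Filter.Frequently.of_forall h)

lemma analyticAt_framedForm (X : Matrix (Fin 6) (Fin 6) ℝ) (I J : Fin 6) (p : ℝ × ℝ) :
    AnalyticAt ℝ (fun p : ℝ × ℝ => framedForm X p.1 p.2 I J) p := by
  have hF (i j : Fin 4) : AnalyticAt ℝ (fun p : ℝ × ℝ => nullFrame p.1 p.2 i j) p := by
    suffices ∀ f g : ℝ × ℝ → ℝ, AnalyticAt ℝ f p → AnalyticAt ℝ g p →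
        AnalyticAt ℝ (fun p => nullFrame (f p) (g p) i j) p from
          this _ _ analyticAt_fst analyticAt_snd
    intro f g hf hg
    fin_cases i <;> fin_cases j <;> simp [nullFrame] <;> fun_prop
  have hC (I J : Fin 6) : AnalyticAt ℝ (fun p : ℝ × ℝ => compound (nullFrame p.1 p.2) I J) p :=
    ((hF _ _).mul (hF _ _)).sub ((hF _ _).mul (hF _ _))
  simp only [framedForm, Matrix.mul_apply, transpose_apply]
  exact Finset.analyticAt_fun_sum _ fun K _ => (Finset.analyticAt_fun_sum _ fun K' _ =>
    (hC _ _).mul analyticAt_const).mul (hC _ _)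

lemma continuous_gramGrad {E : Type*} [TopologicalSpace E] {Y : E → Matrix (Fin 6) (Fin 6) ℝ}
    (hY : ∀ I J, Continuous fun p => Y p I J) : Continuous fun p => gramGrad (Y p) 2 := by
  simp only [gramGrad, cons_val]
  fun_prop

/-- Where the gradient does not vanish identically, the screen determinant does. -/
lemma screen_eq_zero {X : Matrix (Fin 6) (Fin 6) ℝ} (hX : X.IsSymm) {g : (Fin 4 → ℝ) → ℝ}
    (h : HasGram X g) (hg : ∀ ξ : Fin 4 → ℝ, ξ 0 * ξ 3 = ξ 1 ^ 2 + ξ 2 ^ 2 → g ξ = 0) {x₀ y₀ : ℝ}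
    (hR : gramGrad (framedForm X x₀ y₀) 2 ≠ 0) (x y : ℝ) :
    framedForm X x y 0 0 * framedForm X x y 1 1 - framedForm X x y 0 1 ^ 2 = 0 := by
  have hA := analyticAt_framedForm X
  have hc := continuous_gramGrad fun I J => continuous_iff_continuousAt.2 fun p =>
    (hA I J p).continuousAt
  exact eq_zero_of_mul_eq_zero_of_analyticOnNhd (p := (x₀, y₀))
    (fun p _ => ((hA 0 0 p).fun_mul (hA 1 1 p)).fun_sub ((hA 0 1 p).fun_pow 2)) hc
    (fun p => screen_mul_gramGrad (isSymm_framedForm hX p.1 p.2) (h.framed_eq_zero hg p.1 p.2))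
    hR (x, y)

open ComplexConjugate in
lemma polarize {F : ℂ → ℂ → ℂ} (hF : Differentiable ℂ fun p : ℂ × ℂ => F p.1 p.2)
    (h : ∀ w, F w (conj w) = 0) (w v : ℂ) : F w v = 0 := by
  have h₁ (x : ℝ) (z : ℂ) : F (x + Complex.I * z) (x - Complex.I * z) = 0 :=
    eq_zero_of_forall_ofReal (f := fun z => F (x + Complex.I * z) (x - Complex.I * z))
      (hF.comp (f := fun z : ℂ => (x + Complex.I * z, x - Complex.I * z)) (by fun_prop))
      (fun y => by simpa [sub_eq_add_neg] using h (x + Complex.I * y)) z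
  have h₂ (x z : ℂ) : F (x + Complex.I * z) (x - Complex.I * z) = 0 :=
    eq_zero_of_forall_ofReal (f := fun x => F (x + Complex.I * z) (x - Complex.I * z))
      (hF.comp (f := fun x : ℂ => (x + Complex.I * z, x - Complex.I * z)) (by fun_prop))
      (fun x => h₁ x z) x
  convert h₂ ((w + v) / 2) ((w - v) / (2 * Complex.I)) using 1
  congr 1 <;> field_simp <;> ring

/-- The polynomial with coefficients `p` of degree at most four. -/
def quartic (p : Fin 5 → ℂ) (w : ℂ) : ℂ :=
  p 0 + p 1 * w + p 2 * w ^ 2 + p 3 * w ^ 3 + p 4 * w ^ 4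

/-- The polynomial with coefficients `f` of degree at most two. -/
def quadratic (f : Fin 3 → ℂ) (w : ℂ) : ℂ := f 0 + f 1 * w + f 2 * w ^ 2

/-- The polynomial in two variables with coefficients `h` of degree at most two in each. -/
def biquadratic (h : Matrix (Fin 3) (Fin 3) ℂ) (w v : ℂ) : ℂ :=
  quadratic (fun i => quadratic (h i) v) w

lemma quadratic_ext {f f' : Fin 3 → ℂ} (h : ∀ w, quadratic f w = quadratic f' w) (i : Fin 3) :
    f i = f' i := by
  have h0 := h 0
  have h1 := h 1
  have h2 := h (-1)
  simp only [quadratic] at h0 h1 h2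
  fin_cases i <;> simp only [Fin.zero_eta, Fin.mk_one, Fin.reduceFinMk]
  · linear_combination h0
  · linear_combination h1 / 2 - h2 / 2
  · linear_combination h1 / 2 + h2 / 2 - h0

lemma quartic_ext {p p' : Fin 5 → ℂ} (h : ∀ w, quartic p w = quartic p' w) (i : Fin 5) :
    p i = p' i := by
  have h0 := h 0
  have h1 := h 1
  have h2 := h (-1)
  have h3 := h 2
  have h4 := h (-2)
  simp only [quartic] at h0 h1 h2 h3 h4
  fin_cases i <;> simp only [Fin.zero_eta, Fin.mk_one, Fin.reduceFinMk]
  · linear_combination h0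
  · linear_combination 2 / 3 * (h1 - h2) - (h3 - h4) / 12
  · linear_combination 2 / 3 * (h1 + h2) - (h3 + h4) / 24 - 5 / 4 * h0
  · linear_combination (h3 - h4) / 12 - (h1 - h2) / 6
  · linear_combination (h3 + h4) / 24 - (h1 + h2) / 6 + h0 / 4

lemma quadratic_sq (f : Fin 3 → ℂ) (w : ℂ) : quadratic f w ^ 2 =
    quartic ![f 0 ^ 2, 2 * f 0 * f 1, 2 * f 0 * f 2 + f 1 ^ 2, 2 * f 1 * f 2, f 2 ^ 2] w := by
  simp only [quadratic, quartic, cons_val]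
  ring

open ComplexConjugate in
lemma exists_rank_one {p : Fin 5 → ℂ} {h : Matrix (Fin 3) (Fin 3) ℂ}
    (hh : ∀ i j, h j i = conj (h i j))
    (H : ∀ w, quartic p w * conj (quartic p w) = biquadratic h w (conj w) ^ 2) :
    ∃ (r : ℝ) (f : Fin 3 → ℂ), r ≠ 0 ∧ (∀ i j, r * h i j = f i * conj (f j)) ∧
      ∀ k, r * p k =
        ![f 0 ^ 2, 2 * f 0 * f 1, 2 * f 0 * f 2 + f 1 ^ 2, 2 * f 1 * f 2, f 2 ^ 2] k := by
  have hconj (w : ℂ) : conj (quartic p w) = quartic (fun k => conj (p k)) (conj w) := by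
    simp [quartic]
  have hpol (w v : ℂ) : quartic p w * quartic (fun k => conj (p k)) v = biquadratic h w v ^ 2 := by
    refine sub_eq_zero.1 (polarize (F := fun w v =>
      quartic p w * quartic (fun k => conj (p k)) v - biquadratic h w v ^ 2) ?_ (fun w => ?_) w v)
    · simp only [quartic, biquadratic, quadratic]
      fun_prop
    · rw [← hconj, H, sub_self]
  by_cases hp : ∀ w, quartic p w = 0
  · refine ⟨1, 0, one_ne_zero, fun i j => ?_, fun k => ?_⟩
    · have hb (w v : ℂ) : biquadratic h w v = 0 := by simpa [hp] using (hpol w v).symm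
      have := quadratic_ext (f := h i) (f' := 0) (fun v => quadratic_ext
        (f := fun i => quadratic (h i) v) (f' := fun _ => quadratic 0 v)
        (fun w => (hb w v).trans (by simp [quadratic])) i) j
      simp [this]
    · have := quartic_ext (p := p) (p' := 0) (fun w => (hp w).trans (by simp [quartic])) k
      rw [this]
      fin_cases k <;> simp
  obtain ⟨w₀, hw₀⟩ := not_forall.1 hp
  have hdet : (biquadratic h w₀ (conj w₀)) ^ 2 ≠ 0 := by
    rw [← H]
    exact mul_ne_zero hw₀ ((map_ne_zero _).2 hw₀)
  have hr0 := ne_zero_pow two_ne_zero hdet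
  have hmul (w v : ℂ) : biquadratic h w v * biquadratic h w₀ (conj w₀) =
      biquadratic h w (conj w₀) * biquadratic h w₀ v := by
    have hAB := eq_zero_of_mul_eq_zero_of_analyticOnNhd (𝕜 := ℂ) (p := (w₀, conj w₀)) (q := (w, v))
      (f := fun p : ℂ × ℂ => biquadratic h p.1 p.2 * biquadratic h w₀ (conj w₀) -
        biquadratic h p.1 (conj w₀) * biquadratic h w₀ p.2)
      (g := fun p : ℂ × ℂ => biquadratic h p.1 p.2 * biquadratic h w₀ (conj w₀) +
        biquadratic h p.1 (conj w₀) * biquadratic h w₀ p.2) ?_ ?_ (fun q => ?_) ?_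
    · exact sub_eq_zero.1 hAB
    · intro p _
      simp only [biquadratic, quadratic]
      have h₁ : AnalyticAt ℂ (fun p : ℂ × ℂ => p.1) p := analyticAt_fst
      have h₂ : AnalyticAt ℂ (fun p : ℂ × ℂ => p.2) p := analyticAt_snd
      fun_prop
    · simp only [biquadratic, quadratic]
      fun_prop
    · linear_combination -biquadratic h w₀ (conj w₀) ^ 2 * hpol q.1 q.2 -
        quartic p q.1 * quartic (fun k => conj (p k)) q.2 * hpol w₀ (conj w₀) +
        biquadratic h w₀ q.2 ^ 2 * hpol q.1 (conj w₀) +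
        quartic p q.1 * quartic (fun k => conj (p k)) (conj w₀) * hpol w₀ q.2
    · simp only
      rw [← sq, ← two_mul]
      exact mul_ne_zero two_ne_zero hdet
  have hherm (w v : ℂ) : conj (biquadratic h w v) = biquadratic h (conj v) (conj w) := by
    simp only [biquadratic, quadratic, map_add, map_mul, map_pow, ← hh]
    ring
  obtain ⟨r, hr⟩ : ∃ r : ℝ, (r : ℂ) = biquadratic h w₀ (conj w₀) :=
    ⟨_, Complex.conj_eq_iff_re.1 (by rw [hherm, Complex.conj_conj])⟩
  have hrc : (r : ℂ) ≠ 0 := hr ▸ hr0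
  set f : Fin 3 → ℂ := fun i => quadratic (h i) (conj w₀)
  have hfw (w : ℂ) : biquadratic h w (conj w₀) = quadratic f w := rfl
  have hfv (v : ℂ) : biquadratic h w₀ v = quadratic (fun j => conj (f j)) v := by
    have := hherm (conj v) (conj w₀)
    rw [Complex.conj_conj, Complex.conj_conj] at this
    rw [← this, hfw]
    simp [quadratic]
  have hh' (i j : Fin 3) : r * h i j = f i * conj (f j) := by
    refine quadratic_ext (f := fun j => r * h i j) (f' := fun j => f i * conj (f j)) (fun v => ?_) j
    have := quadratic_ext (f := fun i => r * quadratic (h i) v)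
      (f' := fun i => f i * quadratic (fun j => conj (f j)) v) (fun w => ?_) i
    · simp only [quadratic] at this ⊢
      linear_combination this
    · have := hmul w v
      rw [← hr, hfw, hfv v] at this
      simp only [biquadratic, quadratic] at this ⊢
      linear_combination this
  set c := conj (quartic p w₀) with hc
  have hc0 : c ≠ 0 := (map_ne_zero _).2 hw₀
  have hcp (w : ℂ) : c * quartic p w = quadratic f w ^ 2 := by
    rw [← hfw, ← hpol, hc, hconj, mul_comm]
  obtain ⟨u, hu⟩ := IsAlgClosed.exists_pow_nat_eq ((r : ℂ) / c) two_pos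
  have hu1 : u * conj u = 1 := by
    have h₁ : ‖(r : ℂ)‖ ^ 2 = ‖c‖ ^ 2 := by
      rw [← norm_pow, hr, ← H, norm_mul, Complex.norm_conj, sq]
    have h₂ : ‖u‖ ^ 2 = 1 := by
      rw [← norm_pow, hu, norm_div, (sq_eq_sq₀ (norm_nonneg _) (norm_nonneg _)).1 h₁,
        div_self (norm_ne_zero_iff.2 hc0)]
    rw [Complex.mul_conj, Complex.normSq_eq_norm_sq, h₂, Complex.ofReal_one]
  refine ⟨r, fun i => u * f i, by exact_mod_cast hrc, fun i j => ?_, fun k => ?_⟩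
  · rw [hh', map_mul]
    linear_combination -f i * conj (f j) * hu1
  · refine quartic_ext (p := fun k => r * p k) (fun w => ?_) k
    rw [← quadratic_sq fun i => u * f i]
    have : (r : ℂ) = u ^ 2 * c := by rw [hu, div_mul_cancel₀ _ hc0]
    calc _ = r * quartic p w := by simp only [quartic]; ring
      _ = u ^ 2 * quadratic f w ^ 2 := by rw [this, mul_assoc, hcp]
      _ = _ := by simp only [quadratic]; ring

/-- The coefficients of `X (φ, φ)`, where `φ` is the complex null two-form of the screen. -/
def screenCoeff (X : Matrix (Fin 6) (Fin 6) ℝ) : Fin 5 → ℂ :=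
  ![⟨X 0 0 - X 1 1, 2 * X 0 1⟩, ⟨4 * X 0 2 - 2 * X 1 5, 4 * X 1 2 + 2 * X 0 5⟩,
    ⟨4 * X 2 2 - X 5 5 + 2 * X 1 3 - 2 * X 0 4, 4 * X 2 5 - 2 * X 0 3 - 2 * X 1 4⟩,
    ⟨2 * X 3 5 - 4 * X 2 4, -4 * X 2 3 - 2 * X 4 5⟩, ⟨X 4 4 - X 3 3, 2 * X 3 4⟩]

/-- The coefficients of `X (φ, φ̄)`, where `φ` is the complex null two-form of the screen. -/
def screenHerm (X : Matrix (Fin 6) (Fin 6) ℝ) : Matrix (Fin 3) (Fin 3) ℂ :=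
  !![⟨X 0 0 + X 1 1, 0⟩, ⟨2 * X 0 2 + X 1 5, 2 * X 1 2 - X 0 5⟩, ⟨-X 0 4 - X 1 3, X 0 3 - X 1 4⟩;
    ⟨2 * X 0 2 + X 1 5, X 0 5 - 2 * X 1 2⟩, ⟨4 * X 2 2 + X 5 5, 0⟩,
    ⟨-2 * X 2 4 - X 3 5, 2 * X 2 3 - X 4 5⟩;
    ⟨-X 0 4 - X 1 3, X 1 4 - X 0 3⟩, ⟨-2 * X 2 4 - X 3 5, X 4 5 - 2 * X 2 3⟩,
    ⟨X 3 3 + X 4 4, 0⟩]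

lemma framedForm_apply {X : Matrix (Fin 6) (Fin 6) ℝ} (hX : X.IsSymm) (w : ℂ) :
    (⟨framedForm X w.re w.im 0 0 - framedForm X w.re w.im 1 1,
      2 * framedForm X w.re w.im 0 1⟩ : ℂ) =
      quartic (screenCoeff X) w ∧
    ((framedForm X w.re w.im 0 0 + framedForm X w.re w.im 1 1 : ℝ) : ℂ) =
      biquadratic (screenHerm X) w (starRingEnd ℂ w) := by
  obtain ⟨x, y⟩ := w
  have e (i j : Fin 6) : X j i = X i j := hX.apply i j
  have h0 : compound (nullFrame x y) 0 = ![1, 0, 2 * x, 2 * x * y, y ^ 2 - x ^ 2, -y] := by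
    ext I
    fin_cases I <;> simp [compound, wedge, nullFrame, pairs] <;> ring
  have h1 : compound (nullFrame x y) 1 = ![0, 1, 2 * y, y ^ 2 - x ^ 2, -(2 * x * y), x] := by
    ext I
    fin_cases I <;> simp [compound, wedge, nullFrame, pairs] <;> ring
  have h (I J : Fin 6) : framedForm X x y I J =
      compound (nullFrame x y) I ᵥ* X ⬝ᵥ compound (nullFrame x y) J := rfl
  simp only [h, h0, h1, vecMul, dotProduct, Fin.sum_univ_six, cons_val, e 0 1, e 0 2, e 0 3, e 0 4,
    e 0 5, e 1 2, e 1 3, e 1 4, e 1 5, e 2 3, e 2 4, e 2 5, e 3 4, e 3 5, e 4 5]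
  refine ⟨?_, ?_⟩ <;> apply Complex.ext <;>
    simp [quartic, biquadratic, quadratic, screenCoeff, screenHerm, pow_succ] <;> ring

lemma exists_eq_smul_add_vecMulVec {X : Matrix (Fin 6) (Fin 6) ℝ} (hX : X.IsSymm)
    (h : ∀ x y, framedForm X x y 0 0 * framedForm X x y 1 1 - framedForm X x y 0 1 ^ 2 = 0) :
    ∃ (α β ρ : ℝ) (b : Fin 6 → ℝ), ρ ≠ 0 ∧
      X = α • wedgeMat + β • compound nullForm + ρ • vecMulVec b b := by
  have e (i j : Fin 6) : X j i = X i j := hX.apply i j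
  obtain ⟨r, f, hr, hh, hp⟩ := exists_rank_one (p := screenCoeff X) (h := screenHerm X)
    (fun i j => by
      fin_cases i <;> fin_cases j <;> apply Complex.ext <;> simp [screenHerm])
    (fun w => by
      obtain ⟨h₁, h₂⟩ := framedForm_apply hX w
      rw [← h₁, ← h₂, Complex.mul_conj]
      norm_cast
      rw [Complex.normSq_mk]
      linear_combination -4 * h w.re w.im)
  have hre (i j : Fin 3) := congrArg Complex.re (hh i j)
  have him (i j : Fin 3) := congrArg Complex.im (hh i j)
  have hpre (k : Fin 5) := congrArg Complex.re (hp k)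
  have hpim (k : Fin 5) := congrArg Complex.im (hp k)
  obtain ⟨b, hb⟩ : ∃ b : Fin 6 → ℝ,
      b = ![(f 0).re, (f 0).im, (f 1).re / 2, -(f 2).im, -(f 2).re, (f 1).im] := ⟨_, rfl⟩
  refine ⟨X 0 3 - b 0 * b 3 / r, X 5 5 - b 5 ^ 2 / r, r⁻¹, b, inv_ne_zero hr, ?_⟩
  simp only [Fin.forall_fin_succ, Complex.mul_re, Complex.mul_im, Complex.conj_re, Complex.conj_im,
    screenCoeff, screenHerm, Complex.ofReal_re, Complex.ofReal_im, cons_val] at hre him hpre hpim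
  simp [pow_succ] at hre him hpre hpim
  obtain ⟨⟨e00, e01, e02⟩, ⟨-, e11, e12⟩, -, -, e22⟩ := hre
  obtain ⟨⟨-, i01, i02⟩, ⟨-, -, i12⟩, -⟩ := him
  obtain ⟨p0, p1, p2, p3, p4⟩ := hpre
  obtain ⟨q0, q1, q2, q3, q4⟩ := hpim
  have hC : compound nullForm = !![0, 0, 0, 0, -1 / 2, 0; 0, 0, 0, 1 / 2, 0, 0;
      0, 0, -1 / 4, 0, 0, 0; 0, 1 / 2, 0, 0, 0, 0; -1 / 2, 0, 0, 0, 0, 0; 0, 0, 0, 0, 0, 1] := by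
    ext I J
    fin_cases I <;> fin_cases J <;> simp [compound, wedge, pairs, nullForm] <;> norm_num
  have hW : wedgeMat = !![0, 0, 0, 1, 0, 0; 0, 0, 0, 0, 1, 0; 0, 0, 0, 0, 0, 1;
      1, 0, 0, 0, 0, 0; 0, 1, 0, 0, 0, 0; 0, 0, 1, 0, 0, 0] := by
    ext I J
    fin_cases I <;> fin_cases J <;> simp [wedgeMat]
  ext I J
  fin_cases I <;> fin_cases J <;>
    simp only [Fin.zero_eta, Fin.mk_one, Fin.reduceFinMk, e 0 1, e 0 2, e 0 3, e 0 4,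
      e 0 5, e 1 2, e 1 3, e 1 4, e 1 5, e 2 3, e 2 4, e 2 5, e 3 4, e 3 5, e 4 5, hb,
      Matrix.add_apply, Matrix.smul_apply, vecMulVec_apply, hC, hW, of_apply, cons_val,
      smul_eq_mul, mul_zero, mul_one, zero_add, add_zero] <;>
    field_simp <;> linarith

lemma exists_det_ne_zero {ξ : Fin 4 → ℝ} (hξ : ξ ≠ 0) :
    ∃ a b c, (of ![ξ, a, b, c]).det ≠ 0 := by
  obtain ⟨i, hi⟩ := Function.ne_iff.1 hξ
  fin_cases i
  · exact ⟨![0, 1, 0, 0], ![0, 0, 1, 0], ![0, 0, 0, 1], by simpa [det_fin_four] using hi⟩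
  · exact ⟨![1, 0, 0, 0], ![0, 0, 1, 0], ![0, 0, 0, 1], by simpa [det_fin_four] using hi⟩
  · exact ⟨![1, 0, 0, 0], ![0, 1, 0, 0], ![0, 0, 0, 1], by simpa [det_fin_four] using hi⟩
  · exact ⟨![1, 0, 0, 0], ![0, 1, 0, 0], ![0, 0, 1, 0], by simpa [det_fin_four] using hi⟩

lemma wedge_dotProduct_wedgeMat_wedge_left (ξ a b : Fin 4 → ℝ) :
    wedge ξ a ⬝ᵥ wedgeMat *ᵥ wedge ξ b = 0 := by
  rw [wedge_dotProduct_wedgeMat]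
  exact det_zero_of_row_eq (i := 0) (j := 2) (by decide) rfl

lemma gram3_smul_wedgeMat_add (α : ℝ) (X : Matrix (Fin 6) (Fin 6) ℝ) (ξ a b c : Fin 4 → ℝ) :
    gram3 (α • wedgeMat + X) ξ a b c = gram3 X ξ a b c := by
  simp only [gram3, add_mulVec, smul_mulVec, dotProduct_add, dotProduct_smul,
    wedge_dotProduct_wedgeMat_wedge_left, smul_zero, zero_add]

lemma gram3_smul_vecMulVec (ρ : ℝ) (v : Fin 6 → ℝ) (ξ a b c : Fin 4 → ℝ) :
    gram3 (ρ • vecMulVec v v) ξ a b c = 0 := by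
  have h (x y : Fin 6 → ℝ) : x ⬝ᵥ (ρ • vecMulVec v v) *ᵥ y = ρ * (x ⬝ᵥ v) * (y ⬝ᵥ v) := by
    rw [smul_mulVec, vecMulVec_mulVec, dotProduct_smul, op_smul_eq_smul, dotProduct_smul,
      dotProduct_comm v y, smul_eq_mul, smul_eq_mul]
    ring
  simp only [gram3, h, det_fin_three, of_apply, cons_val]
  ring

lemma wedge_dotProduct_compound (h : Matrix (Fin 4) (Fin 4) ℝ) (a b c d : Fin 4 → ℝ) :
    wedge a b ⬝ᵥ compound h *ᵥ wedge c d =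
      (a ⬝ᵥ h *ᵥ c) * (b ⬝ᵥ h *ᵥ d) - (a ⬝ᵥ h *ᵥ d) * (b ⬝ᵥ h *ᵥ c) := by
  rw [dotProduct_mulVec, ← wedge_vecMul]
  simp only [dotProduct_mulVec]
  generalize a ᵥ* h = a
  generalize b ᵥ* h = b
  simp only [wedge, pairs, dotProduct, Fin.sum_univ_four, Fin.sum_univ_six, cons_val]
  ring

lemma gram3_smul_compound (β : ℝ) {h : Matrix (Fin 4) (Fin 4) ℝ} (hh : h.IsSymm)
    (ξ a b c : Fin 4 → ℝ) :
    gram3 (β • compound h) ξ a b c =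
      β ^ 3 * (ξ ⬝ᵥ h *ᵥ ξ) ^ 2 * h.det * (of ![ξ, a, b, c]).det ^ 2 := by
  have hc (x y : Fin 4 → ℝ) : y ⬝ᵥ h *ᵥ x = x ⬝ᵥ h *ᵥ y := by
    rw [dotProduct_mulVec, ← mulVec_transpose, hh.eq, dotProduct_comm]
  have hM : h.det * (of ![ξ, a, b, c]).det ^ 2 =
      (of fun i j => ![ξ, a, b, c] i ⬝ᵥ h *ᵥ ![ξ, a, b, c] j).det := by
    have : (of fun i j => ![ξ, a, b, c] i ⬝ᵥ h *ᵥ ![ξ, a, b, c] j) =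
        of ![ξ, a, b, c] * h * (of ![ξ, a, b, c])ᵀ := by
      ext i j
      exact dotProduct_mulVec (![ξ, a, b, c] i) h (![ξ, a, b, c] j)
    rw [this, det_mul, det_mul, det_transpose]
    ring
  rw [mul_assoc, hM, det_fin_four]
  simp only [gram3, smul_mulVec, dotProduct_smul, wedge_dotProduct_compound, det_fin_three,
    of_apply, cons_val, smul_eq_mul, hc ξ a, hc ξ b, hc ξ c, hc a b, hc a c, hc b c]
  ring

lemma dotProduct_nullForm_mulVec (ξ : Fin 4 → ℝ) :
    ξ ⬝ᵥ nullForm *ᵥ ξ = ξ 0 * ξ 3 - ξ 1 ^ 2 - ξ 2 ^ 2 := by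
  simp only [nullForm, dotProduct, mulVec, Fin.sum_univ_four, of_apply, cons_val]
  ring

lemma isSymm_nullForm : nullForm.IsSymm := by
  ext i j
  fin_cases i <;> fin_cases j <;> rfl

lemma exists_ne_zero_and_eq_smul_add_vecMulVec {X : Matrix (Fin 6) (Fin 6) ℝ}
    {g : (Fin 4 → ℝ) → ℝ} (hX : X.IsSymm) (h : HasGram X g) (hq : IsQuartic g)
    (hg : ∀ ξ : Fin 4 → ℝ, ξ ⬝ᵥ nullForm *ᵥ ξ = 0 → g ξ = 0)
    (hplane : ∀ u v : Fin 4 → ℝ, (∀ s t : ℝ, g (s • u + t • v) = 0) →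
      ∃ s t : ℝ, (s ≠ 0 ∨ t ≠ 0) ∧ s • u + t • v = 0)
    {ξ : Fin 4 → ℝ} (hgξ : g ξ = 0) (hξ : ξ ⬝ᵥ nullForm *ᵥ ξ ≠ 0) :
    ∃ (α β ρ : ℝ) (b : Fin 6 → ℝ), β ≠ 0 ∧ ρ ≠ 0 ∧ b ≠ 0 ∧
      X = α • wedgeMat + β • compound nullForm + ρ • vecMulVec b b := by
  have hg' (η : Fin 4 → ℝ) (hη : η 0 * η 3 = η 1 ^ 2 + η 2 ^ 2) : g η = 0 :=
    hg η (by rw [dotProduct_nullForm_mulVec, hη]; ring)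
  obtain ⟨x, y, hR⟩ := exists_gramGrad_ne_zero hX h hq hg' hplane hgξ
    (dotProduct_nullForm_mulVec ξ ▸ hξ)
  obtain ⟨α, β, ρ, b, hρ, rfl⟩ :=
    exists_eq_smul_add_vecMulVec hX (screen_eq_zero hX h hg' hR)
  have hβ : β ≠ 0 := by
    rintro rfl
    have hzero (η : Fin 4 → ℝ) : g η = 0 := by
      by_cases hη : η = 0
      · exact hg η (by rw [hη, zero_dotProduct])
      obtain ⟨a₁, a₂, a₃, ha⟩ := exists_det_ne_zero hη
      have := h η a₁ a₂ a₃
      rw [zero_smul, add_zero, gram3_smul_wedgeMat_add, gram3_smul_vecMulVec] at this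
      simpa [ha] using this
    obtain ⟨s, t, hst, h0⟩ := hplane ![1, 0, 0, 0] ![0, 1, 0, 0] fun _ _ => hzero _
    have h₁ := congrFun h0 0
    have h₂ := congrFun h0 1
    simp at h₁ h₂
    simp [h₁, h₂] at hst
  refine ⟨α, β, ρ, b, hβ, hρ, ?_, rfl⟩
  rintro rfl
  have hξ0 : ξ ≠ 0 := by
    rintro rfl
    simp at hξ
  obtain ⟨a₁, a₂, a₃, ha⟩ := exists_det_ne_zero hξ0
  have hG := h ξ a₁ a₂ a₃
  rw [zero_vecMulVec, smul_zero, add_zero, gram3_smul_wedgeMat_add,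
    gram3_smul_compound β isSymm_nullForm, hgξ, det_nullForm] at hG
  exact hβ (by simpa [ha, hξ] using hG)

lemma isQuartic_fresnel (κ : MT) : IsQuartic (fresnel κ) := by
  intro u v
  refine ⟨![∑ i, ∑ j, ∑ k, ∑ l, G0 κ i j k l * (u i * u j * u k * u l),
    ∑ i, ∑ j, ∑ k, ∑ l, G0 κ i j k l * (v i * u j * u k * u l + u i * v j * u k * u l +
      u i * u j * v k * u l + u i * u j * u k * v l),
    ∑ i, ∑ j, ∑ k, ∑ l, G0 κ i j k l * (v i * v j * u k * u l + v i * u j * v k * u l +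
      v i * u j * u k * v l + u i * v j * v k * u l + u i * v j * u k * v l +
      u i * u j * v k * v l),
    ∑ i, ∑ j, ∑ k, ∑ l, G0 κ i j k l * (u i * v j * v k * v l + v i * u j * v k * v l +
      v i * v j * u k * v l + v i * v j * v k * u l),
    ∑ i, ∑ j, ∑ k, ∑ l, G0 κ i j k l * (v i * v j * v k * v l)], fun s t => ?_⟩
  simp only [cons_val, Finset.sum_mul, ← Finset.sum_add_distrib, fresnel, Pi.add_apply,
    Pi.smul_apply, smul_eq_mul]
  refine Finset.sum_congr rfl fun i _ => Finset.sum_congr rfl fun j _ =>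
    Finset.sum_congr rfl fun k _ => Finset.sum_congr rfl fun l _ => ?_
  ring

lemma IsQuartic.comp_vecMul {g : (Fin 4 → ℝ) → ℝ} (hg : IsQuartic g)
    (L : Matrix (Fin 4) (Fin 4) ℝ) (r : ℝ) : IsQuartic fun ξ => g (ξ ᵥ* L) * r := by
  intro u v
  obtain ⟨c, hc⟩ := hg (u ᵥ* L) (v ᵥ* L)
  refine ⟨fun i => c i * r, fun s t => ?_⟩
  simp only [add_vecMul, smul_vecMul, hc]
  ring

lemma exists_wedgeMat_mul_eq {κ : MT} (hκ : antisymMT κ) (hX : (wedgeMat * mat6 κ).IsSymm)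
    {gp gm : Matrix (Fin 4) (Fin 4) ℝ} (hgp : IsLorentz gp) (hgm : IsLorentz gm)
    (hF : {ξ | fresnel κ ξ = 0} = nullCone gp ∪ nullCone gm) {ξ : Fin 4 → ℝ}
    (hξm : ξ ∈ nullCone gm) (hξp : ξ ∉ nullCone gp) :
    ∃ (α β ρ : ℝ) (b : Fin 6 → ℝ), β ≠ 0 ∧ ρ ≠ 0 ∧ b ≠ 0 ∧
      wedgeMat * mat6 κ = α • wedgeMat + β • compound gp⁻¹ + ρ • vecMulVec b b := by
  have hF' (η : Fin 4 → ℝ) : fresnel κ η = 0 ↔ η ∈ nullCone gp ∪ nullCone gm := by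
    rw [← hF]
    rfl
  obtain ⟨ε, L, hε, hL⟩ := exists_mul_mul_transpose_eq_nullForm hgp.inv.1 hgp.inv.2
  have hε0 : ε ≠ 0 := by
    rintro rfl
    simp at hε
  have hdet : L.det ≠ 0 := by
    intro h0
    have := congrArg det hL
    rw [det_mul, det_mul, h0, det_smul, det_nullForm] at this
    simp [hε0] at this
  have hLL : L * L⁻¹ = 1 := mul_nonsing_inv _ (isUnit_iff_ne_zero.2 hdet)
  have hLL' : L⁻¹ * L = 1 := nonsing_inv_mul _ (isUnit_iff_ne_zero.2 hdet)
  have hnull (η : Fin 4 → ℝ) : η ᵥ* L ∈ nullCone gp ↔ η ⬝ᵥ nullForm *ᵥ η = 0 := by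
    have : (η ᵥ* L) ⬝ᵥ gp⁻¹ *ᵥ (η ᵥ* L) = ε * (η ⬝ᵥ nullForm *ᵥ η) := by
      rw [← smul_eq_mul, ← dotProduct_smul, ← smul_mulVec, ← hL, ← mulVec_transpose L η,
        ← mulVec_mulVec, ← mulVec_mulVec, dotProduct_mulVec η L, mulVec_transpose]
    rw [mem_nullCone_iff, this, mul_eq_zero, or_iff_right hε0]
  have hgram : HasGram (compound L * (wedgeMat * mat6 κ) * (compound L)ᵀ)
      fun η => fresnel κ (η ᵥ* L) * L.det ^ 2 := by
    intro η a b c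
    rw [gram3_compound, gram3_eq_fresnel κ hκ hX, det_of_vecMul]
    ring
  obtain ⟨α, β, ρ, b, hβ, hρ, hb, h⟩ := exists_ne_zero_and_eq_smul_add_vecMulVec
    (ξ := ξ ᵥ* L⁻¹) (by rw [IsSymm, transpose_mul, transpose_mul, transpose_transpose, hX.eq,
      ← mul_assoc]) hgram
    ((isQuartic_fresnel κ).comp_vecMul L _)
    (fun η hη => by
      rw [(hF' _).2 (Or.inl ((hnull η).2 hη)), zero_mul])
    (fun u v huv => by
      obtain ⟨s, t, hst, h0⟩ := exists_smul_add_smul_eq_zero_of_subset hgp hgm (u ᵥ* L) (v ᵥ* L)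
        fun s t => by
          have := huv s t
          rw [add_vecMul, smul_vecMul, smul_vecMul] at this
          exact (hF' _).1 (by simpa [hdet] using this)
      refine ⟨s, t, hst, ?_⟩
      rw [← smul_vecMul, ← smul_vecMul, ← add_vecMul] at h0
      rw [← vecMul_one (s • u + t • v), ← hLL, ← vecMul_vecMul, h0, zero_vecMul])
    (by
      rw [vecMul_vecMul, hLL', vecMul_one, (hF' ξ).2 (Or.inr hξm), zero_mul])
    (by rwa [Ne, ← hnull, vecMul_vecMul, hLL', vecMul_one])
  have hMM : compound L⁻¹ * compound L = 1 := by rw [← compound_mul, hLL', compound_one]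
  have hMM' : compound L * compound L⁻¹ = 1 := by rw [← compound_mul, hLL, compound_one]
  have hMMt : (compound L)ᵀ * (compound L⁻¹)ᵀ = 1 := by
    rw [← transpose_mul, hMM, transpose_one]
  have hC : compound nullForm = compound L * compound gp⁻¹ * (compound L)ᵀ := by
    rw [← compound_transpose, ← compound_mul, ← compound_mul, hL, compound_smul, hε, one_smul]
  refine ⟨α * L⁻¹.det, β, ρ, compound L⁻¹ *ᵥ b, hβ, hρ, fun h0 => hb ?_, ?_⟩
  · rw [← one_mulVec b, ← hMM', ← mulVec_mulVec, h0, mulVec_zero]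
  · have hcancel (Y : Matrix (Fin 6) (Fin 6) ℝ) :
        compound L⁻¹ * (compound L * Y * (compound L)ᵀ) * (compound L⁻¹)ᵀ = Y := by
      rw [← mul_assoc, ← mul_assoc, hMM, one_mul, mul_assoc, hMMt, mul_one]
    rw [← hcancel (wedgeMat * mat6 κ), h, hC, mul_add, mul_add, add_mul, add_mul, mul_smul_comm,
      mul_smul_comm, mul_smul_comm, smul_mul_assoc, smul_mul_assoc, smul_mul_assoc, hcancel,
      compound_mul_wedgeMat_mul_transpose, smul_smul, mul_vecMulVec, vecMulVec_mul,
      vecMul_transpose]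

lemma eps_swap_left (i j k l : Fin 4) : eps i j k l = -eps j i k l := by
  simp only [eps]
  ring

lemma eps_swap_right (i j k l : Fin 4) : eps i j k l = -eps i j l k := by
  simp only [eps]
  ring

lemma eps_pairs (I J : Fin 6) :
    eps (pairs I).1 (pairs I).2 (pairs J).1 (pairs J).2 = wedgeMat I J := by
  fin_cases I <;> fin_cases J <;> simp [eps, pairs, wedgeMat] <;> norm_num

lemma sum_mul_eq_sum_pairs {T S : BV} (hT : antisymBV T) (hS : antisymBV S) :
    ∑ a, ∑ b, T a b * S a b =
      2 * ∑ I, T (pairs I).1 (pairs I).2 * S (pairs I).1 (pairs I).2 := by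
  have hd (i : Fin 4) : T i i = 0 := self_eq_neg.1 (hT i i)
  simp only [Fin.sum_univ_four, Fin.sum_univ_six, pairs, cons_val, hd, hT 1 0, hT 2 0, hT 3 0,
    hT 2 1, hT 3 2, hT 1 3, hS 1 0, hS 2 0, hS 3 0, hS 2 1, hS 3 2, hS 1 3]
  ring

lemma antisymBV_ext {T S : BV} (hT : antisymBV T) (hS : antisymBV S)
    (h : ∀ I, T (pairs I).1 (pairs I).2 = S (pairs I).1 (pairs I).2) : T = S := by
  have hd {T : BV} (hT : antisymBV T) (i : Fin 4) : T i i = 0 := self_eq_neg.1 (hT i i)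
  have hpairs : ∀ i j : Fin 4, i = j ∨ ∃ I, pairs I = (i, j) ∨ pairs I = (j, i) := by decide
  ext i j
  obtain rfl | ⟨I, hI | hI⟩ := hpairs i j
  · rw [hd hT, hd hS]
  · simpa [hI] using h I
  · rw [hT, hS]
    simpa [hI] using h I

lemma antisymMT_ext {κ η : MT} (hκ : antisymMT κ) (hη : antisymMT η) (h : mat6 κ = mat6 η) :
    κ = η := by
  have key (r s : Fin 4) : (fun i j => κ i j r s) = fun i j => η i j r s := by
    refine antisymBV_ext (fun i j => hκ.1 i j r s) (fun i j => hη.1 i j r s) fun J => ?_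
    refine congrFun (congrFun (antisymBV_ext (T := fun r s => κ _ _ r s)
      (S := fun r s => η _ _ r s) (fun r s => hκ.2 _ _ r s) (fun r s => hη.2 _ _ r s)
      fun I => congrFun (congrFun h I) J) r) s
  ext i j r s
  exact congrFun (congrFun (key r s) i) j

lemma antisymMT_idT : antisymMT idT := by
  constructor <;> intros <;> simp only [idT] <;> ring

lemma antisymMT_compT {κ η : MT} (hκ : antisymMT κ) (hη : antisymMT η) :
    antisymMT (compT κ η) := by
  constructor
  · intro i j r s
    simp only [compT, ← mul_neg, ← Finset.sum_neg_distrib, ← hη.1 i j]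
  · intro i j r s
    simp only [compT, hκ.2 _ _ r s, neg_mul, Finset.sum_neg_distrib, mul_neg]

lemma antisymMT_tensAB (ρ : ℝ) (A : BV) {B : BV} (hB : antisymBV B) :
    antisymMT (tensAB ρ A B) := by
  constructor
  · intro i j r s
    simp only [tensAB, ← mul_neg, ← hB i j]
  · intro i j r s
    simp only [tensAB, eps_swap_left r s, neg_mul, Finset.sum_neg_distrib, mul_neg]

lemma mat6_idT : mat6 idT = 1 := by
  ext I J
  fin_cases I <;> fin_cases J <;> simp [mat6, idT, pairs]

lemma mat6_compT {κ η : MT} (hκ : antisymMT κ) (hη : antisymMT η) :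
    mat6 (compT κ η) = mat6 κ * mat6 η := by
  ext I J
  simp only [mat6, compT, Matrix.mul_apply]
  rw [sum_mul_eq_sum_pairs (T := fun a b => κ a b _ _) (S := fun a b => η _ _ a b)
    (fun i j => hκ.1 i j _ _) (fun r s => hη.2 _ _ r s)]
  ring

lemma sum_eps_mul {A : BV} (hA : antisymBV A) (I : Fin 6) :
    ∑ a, ∑ b, eps (pairs I).1 (pairs I).2 a b * A a b =
      2 * (wedgeMat *ᵥ fun J => A (pairs J).1 (pairs J).2) I := by
  rw [sum_mul_eq_sum_pairs (fun a b => eps_swap_right _ _ a b) hA]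
  simp only [eps_pairs]
  rfl

lemma mat6_tensAB (ρ : ℝ) {A : BV} (hA : antisymBV A) (B : BV) :
    mat6 (tensAB ρ A B) = (2 * ρ) • vecMulVec (wedgeMat *ᵥ fun J => A (pairs J).1 (pairs J).2)
      fun J => B (pairs J).1 (pairs J).2 := by
  ext I J
  simp only [mat6, tensAB, sum_eps_mul hA, Matrix.smul_apply, vecMulVec_apply, smul_eq_mul]
  ring

lemma mat6_adjT {κ : MT} (hκ : antisymMT κ) :
    mat6 (adjT κ) = wedgeMat * (mat6 κ)ᵀ * wedgeMat := by
  ext I J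
  have h (a b : Fin 4) : ∑ c, ∑ d, κ a b c d * eps c d (pairs J).1 (pairs J).2 =
      2 * ∑ K, κ a b (pairs K).1 (pairs K).2 * wedgeMat K J := by
    rw [sum_mul_eq_sum_pairs (fun c d => hκ.2 a b c d) (fun c d => eps_swap_left c d _ _)]
    simp only [eps_pairs]
  simp only [mat6, adjT, mul_assoc, ← Finset.mul_sum, h]
  rw [sum_eps_mul (A := fun a b => 2 * ∑ K, κ a b (pairs K).1 (pairs K).2 * wedgeMat K J)
    (fun a b => by
      simp only [hκ.1 a b, neg_mul, Finset.sum_neg_distrib, mul_neg])]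
  simp only [mulVec, dotProduct, Matrix.mul_apply, transpose_apply, mat6, Finset.mul_sum]
  refine Finset.sum_congr rfl fun _ _ => Finset.sum_congr rfl fun _ _ => ?_
  ring

lemma isSymm_wedgeMat_mul_mat6 {κ : MT} (hκ : antisymMT κ) (hskew : adjT κ = κ) :
    (wedgeMat * mat6 κ).IsSymm := by
  have h := mat6_adjT hκ
  rw [hskew] at h
  rw [IsSymm, transpose_mul, wedgeMat_transpose]
  conv_rhs => rw [h, ← mul_assoc, ← mul_assoc, wedgeMat_mul_self, one_mul]

/-- The bivector with components `a` in the ordering `O`. -/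
def toBV (a : Fin 6 → ℝ) : BV := fun i j => ∑ I, a I * idT i j (pairs I).1 (pairs I).2

lemma antisymBV_toBV (a : Fin 6 → ℝ) : antisymBV (toBV a) := by
  intro i j
  simp only [toBV, ← Finset.sum_neg_distrib, ← mul_neg, ← antisymMT_idT.1 i j]

lemma toBV_pairs (a : Fin 6 → ℝ) (J : Fin 6) : toBV a (pairs J).1 (pairs J).2 = a J := by
  have h (I : Fin 6) : idT (pairs J).1 (pairs J).2 (pairs I).1 (pairs I).2 =
      (1 : Matrix (Fin 6) (Fin 6) ℝ) I J :=
    congrFun (congrFun mat6_idT I) J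
  simp [toBV, h, one_apply]

lemma toBV_ne_zero {a : Fin 6 → ℝ} (ha : a ≠ 0) : toBV a ≠ 0 := by
  intro h
  refine ha (funext fun J => ?_)
  rw [← toBV_pairs a J, h]
  rfl

lemma exists_sub_smul_one_sq_eq {K : Matrix (Fin 6) (Fin 6) ℝ} {h : Matrix (Fin 4) (Fin 4) ℝ}
    (hh : IsLorentz h) {α β ρ : ℝ} {b : Fin 6 → ℝ} (hβ : β ≠ 0) (hb : b ≠ 0)
    (hK : wedgeMat * K = α • wedgeMat + β • compound h + ρ • vecMulVec b b) :
    ∃ a : Fin 6 → ℝ, a ≠ 0 ∧ (K - α • 1) * (K - α • 1) = (β ^ 2 * h.det) • 1 +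
      ρ • vecMulVec (wedgeMat *ᵥ a) b + ρ • vecMulVec (wedgeMat *ᵥ b) a := by
  obtain ⟨S, hS⟩ : ∃ S, S = wedgeMat * compound h := ⟨_, rfl⟩
  have hSS : S * S = h.det • 1 := hS ▸ wedgeMat_mul_compound_sq hh.1
  have hK' : K - α • 1 = β • S + ρ • vecMulVec (wedgeMat *ᵥ b) b := by
    rw [← one_mul K, ← wedgeMat_mul_self, mul_assoc, hK, mul_add, mul_add, mul_smul_comm,
      mul_smul_comm, mul_smul_comm, mul_vecMulVec, hS]
    abel
  have hC : (compound h)ᵀ = compound h := by rw [← compound_transpose, hh.1.eq]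
  have hbS : b ᵥ* S = compound h *ᵥ (wedgeMat *ᵥ b) := by
    rw [hS, ← vecMul_vecMul, ← mulVec_transpose, ← mulVec_transpose, wedgeMat_transpose, hC]
  have hWS : wedgeMat *ᵥ (b ᵥ* S) = S *ᵥ (wedgeMat *ᵥ b) := by
    rw [hbS, hS, mulVec_mulVec]
  refine ⟨β • (b ᵥ* S) + (ρ / 2 * (b ⬝ᵥ wedgeMat *ᵥ b)) • b, fun h0 => hb ?_, ?_⟩
  · obtain ⟨γ, hγ⟩ : ∃ γ : ℝ, b ᵥ* S = γ • b := by
      refine ⟨-(β⁻¹ * (ρ / 2 * (b ⬝ᵥ wedgeMat *ᵥ b))), ?_⟩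
      rw [neg_smul, ← smul_smul, ← smul_neg, ← eq_neg_of_add_eq_zero_left h0, smul_smul,
        inv_mul_cancel₀ hβ, one_smul]
    have h1 : b ᵥ* (S * S) = (γ ^ 2) • b := by
      rw [← vecMul_vecMul, hγ, smul_vecMul, hγ, smul_smul, sq]
    rw [hSS, vecMul_smul, vecMul_one, ← sub_eq_zero, ← sub_smul] at h1
    refine (smul_eq_zero.1 h1).resolve_left ?_
    nlinarith [hh.2, sq_nonneg γ]
  · rw [hK', mulVec_add, mulVec_smul, mulVec_smul, hWS, add_mul, mul_add, mul_add,
      smul_mul_smul_comm, hSS, smul_mul_smul_comm, smul_mul_smul_comm, smul_mul_smul_comm,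
      mul_vecMulVec, vecMulVec_mul, vecMulVec_mul_vecMulVec]
    ext i j
    simp only [Matrix.add_apply, Matrix.smul_apply, vecMulVec_apply, Pi.add_apply, Pi.smul_apply,
      smul_eq_mul]
    ring

lemma exists_compT_eq {κ : MT} (hκ : antisymMT κ) {h : Matrix (Fin 4) (Fin 4) ℝ}
    (hh : IsLorentz h) {α β ρ : ℝ} {b : Fin 6 → ℝ} (hβ : β ≠ 0) (hρ : ρ ≠ 0) (hb : b ≠ 0)
    (hK : wedgeMat * mat6 κ = α • wedgeMat + β • compound h + ρ • vecMulVec b b) :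
    ∃ (μ lam ρ : ℝ) (A B : BV), 0 < lam ∧ ρ ≠ 0 ∧
      antisymBV A ∧ antisymBV B ∧ A ≠ 0 ∧ B ≠ 0 ∧
      compT (fun i j r s => κ i j r s + μ * idT i j r s)
          (fun i j r s => κ i j r s + μ * idT i j r s) =
        fun i j r s =>
          -lam * idT i j r s + tensAB ρ A B i j r s + tensAB ρ B A i j r s := by
  obtain ⟨a, ha, hsq⟩ := exists_sub_smul_one_sq_eq hh hβ hb hK
  have hanti : antisymMT fun i j r s => κ i j r s + -α * idT i j r s := by
    refine ⟨fun i j r s => ?_, fun i j r s => ?_⟩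
    · beta_reduce
      rw [hκ.1, antisymMT_idT.1]
      ring
    · beta_reduce
      rw [hκ.2, antisymMT_idT.2]
      ring
  have hmat : mat6 (fun i j r s => κ i j r s + -α * idT i j r s) = mat6 κ - α • 1 := by
    rw [← mat6_idT, sub_eq_add_neg, ← neg_smul]
    rfl
  have hA := antisymBV_toBV a
  have hB := antisymBV_toBV b
  refine ⟨-α, -(β ^ 2 * h.det), ρ / 2, toBV a, toBV b,
    neg_pos.2 (mul_neg_of_pos_of_neg (by positivity) hh.2), by simpa using hρ, hA, hB,
    toBV_ne_zero ha, toBV_ne_zero hb, antisymMT_ext (antisymMT_compT hanti hanti) ?_ ?_⟩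
  · refine ⟨fun i j r s => ?_, fun i j r s => ?_⟩
    · beta_reduce
      rw [antisymMT_idT.1, (antisymMT_tensAB _ _ hB).1, (antisymMT_tensAB _ _ hA).1]
      ring
    · beta_reduce
      rw [antisymMT_idT.2, (antisymMT_tensAB _ _ hB).2, (antisymMT_tensAB _ _ hA).2]
      ring
  · rw [mat6_compT hanti hanti, hmat, hsq]
    trans -(-(β ^ 2 * h.det)) • mat6 idT + mat6 (tensAB (ρ / 2) (toBV a) (toBV b)) +
      mat6 (tensAB (ρ / 2) (toBV b) (toBV a))
    · rw [mat6_tensAB _ hA, mat6_tensAB _ hB, mat6_idT, neg_neg, mul_div_cancel₀ ρ two_ne_zero]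
      simp only [toBV_pairs]
    · rfl

/-- Main theorem, necessity: a skewon-free invertible medium tensor with a
double light cone (a) has a Fresnel surface containing no 2-dimensional
subspace, and (b) satisfies
(κ + μ·Id)² = −λ·Id + ρ(Ā⊗B) + ρ(B̄⊗A) with λ > 0, ρ ≠ 0 and A, B nonzero. -/
theorem stmt14 (κ : MT) (hanti : antisymMT κ) (hskew : adjT κ = κ)
    (hinv : IsUnit (mat6 κ).det)
    (gp gm : Matrix (Fin 4) (Fin 4) ℝ) (hgp : IsLorentz gp) (hgm : IsLorentz gm)
    (hne : nullCone gp ≠ nullCone gm)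
    (hF : {ξ | fresnel κ ξ = 0} = nullCone gp ∪ nullCone gm) :
    (∀ V : Submodule ℝ (Fin 4 → ℝ), Module.finrank ℝ V = 2 →
        ¬((V : Set (Fin 4 → ℝ)) ⊆ {ξ | fresnel κ ξ = 0})) ∧
    ∃ (μ lam ρ : ℝ) (A B : BV), 0 < lam ∧ ρ ≠ 0 ∧
      antisymBV A ∧ antisymBV B ∧ A ≠ 0 ∧ B ≠ 0 ∧
      compT (fun i j r s => κ i j r s + μ * idT i j r s)
          (fun i j r s => κ i j r s + μ * idT i j r s) =
        fun i j r s =>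
          -lam * idT i j r s + tensAB ρ A B i j r s + tensAB ρ B A i j r s := by
  refine ⟨fun V hV hsub => ?_, ?_⟩
  · let v := Module.finBasisOfFinrankEq ℝ V hV
    obtain ⟨s, t, hst, h0⟩ := exists_smul_add_smul_eq_zero_of_subset hgp hgm (v 0) (v 1)
      fun s t => hF ▸ hsub (s • v 0 + t • v 1).2
    have hli := Fintype.linearIndependent_iff.1 v.linearIndependent ![s, t]
      (by simpa [Fin.sum_univ_two] using Subtype.ext h0)
    exact hst.elim (fun hs => hs (hli 0)) fun ht => ht (hli 1)
  · have hX := isSymm_wedgeMat_mul_mat6 hanti hskew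
    obtain ⟨h, α, β, ρ, b, hh, hβ, hρ, hb, hK⟩ : ∃ (h : Matrix (Fin 4) (Fin 4) ℝ) (α β ρ : ℝ)
        (b : Fin 6 → ℝ), IsLorentz h ∧ β ≠ 0 ∧ ρ ≠ 0 ∧ b ≠ 0 ∧
        wedgeMat * mat6 κ = α • wedgeMat + β • compound h + ρ • vecMulVec b b := by
      by_cases hsub : nullCone gm ⊆ nullCone gp
      · obtain ⟨ξ, hξp, hξm⟩ := Set.not_subset.1 fun h => hne (subset_antisymm h hsub)
        obtain ⟨α, β, ρ, b, h⟩ :=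
          exists_wedgeMat_mul_eq hanti hX hgm hgp (by rw [hF, Set.union_comm]) hξp hξm
        exact ⟨_, α, β, ρ, b, hgm.inv, h⟩
      · obtain ⟨ξ, hξm, hξp⟩ := Set.not_subset.1 hsub
        obtain ⟨α, β, ρ, b, h⟩ := exists_wedgeMat_mul_eq hanti hX hgp hgm hF hξm hξp
        exact ⟨_, α, β, ρ, b, hgp.inv, h⟩
    exact exists_compT_eq hanti hh hβ hρ hb hK
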